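/- Let f be an area-preserving positive twist map of the closed annulus A = 𝕋 × [0,1] admitting no f-invariant graph except C₀ and C₁. Then there exist points z and z' in the open annulus 𝕋 × (0,1) such that lim_{k→−∞} d(fᵏ(z), C₀) = lim_{k→+∞} d(fᵏ(z), C₁) = 0 and lim_{k→−∞} d(fᵏ(z'), C₁) = lim_{k→+∞} d(fᵏ(z'), C₀) = 0. -/

import Mathlib

open Set Filter Topology MeasureTheory

noncomputable section

/-- The circle `𝕋 = ℝ/ℤ`. -/
abbrev 𝕋 : Type := AddCircle (1 : ℝ)

/-- The closed annulus `A = 𝕋 × [0,1]`. -/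
abbrev Ann : Type := 𝕋 × ↥(Set.Icc (0:ℝ) 1)

/-- The universal cover `Ã = ℝ × [0,1]`. -/
abbrev StripA : Type := ℝ × ↥(Set.Icc (0:ℝ) 1)

/-- The covering projection `π : Ã → A`. -/
def annProj : StripA → Ann := fun z => ((z.1 : 𝕋), z.2)

/-- The deck translation `T(x̃,y) = (x̃+1,y)`. -/
def deckT : StripA → StripA := fun z => (z.1 + 1, z.2)

/-- The iterated deck translation `T^p`, `p ∈ ℤ`. -/
def deckZ (p : ℤ) : StripA → StripA := fun z => (z.1 + (p : ℝ), z.2)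

/-- The boundary circle `C₀ = 𝕋 × {0}`. -/
def C0 : Set Ann := {z | (z.2 : ℝ) = 0}

/-- The boundary circle `C₁ = 𝕋 × {1}`. -/
def C1 : Set Ann := {z | (z.2 : ℝ) = 1}

/-- A point of `Ã` on the boundary line `ℝ × {0}`. -/
def bd0 (x : ℝ) : StripA := (x, ⟨0, by norm_num⟩)

/-- A point of `Ã` on the boundary line `ℝ × {1}`. -/
def bd1 (x : ℝ) : StripA := (x, ⟨1, by norm_num⟩)

/-- A homeomorphism of the closed annulus isotopic to the identity, together with a
chosen lift to the universal cover.  (A homeomorphism of `A` is isotopic to the identity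
iff it admits a lift commuting with the deck translation and preserving each boundary
line of the strip.) -/
structure AnnulusHomeo where
  toFun : Ann ≃ₜ Ann
  lift : StripA ≃ₜ StripA
  lift_proj : ∀ z : StripA, annProj (lift z) = toFun (annProj z)
  lift_deck : ∀ z : StripA, lift (deckT z) = deckT (lift z)
  lift_bd0 : ∀ z : StripA, (z.2 : ℝ) = 0 → ((lift z).2 : ℝ) = 0

/-- The iterate `f^k`, `k ∈ ℤ`. -/
def AnnulusHomeo.iter (h : AnnulusHomeo) (k : ℤ) : Ann → Ann :=
  fun z => ((h.toFun.toEquiv : Equiv.Perm Ann) ^ k) z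

/-- The iterate `f̃^k` of the lift, `k ∈ ℤ`. -/
def AnnulusHomeo.liftIter (h : AnnulusHomeo) (k : ℤ) : StripA → StripA :=
  fun z => ((h.lift.toEquiv : Equiv.Perm StripA) ^ k) z

/-- `f` is non wandering: every nonempty open set meets one of its forward iterates. -/
def NonWandering (h : AnnulusHomeo) : Prop :=
  ∀ U : Set Ann, IsOpen U → U.Nonempty → ∃ k : ℕ, 0 < k ∧ (h.iter k '' U ∩ U).Nonempty

/-- The closed strip `ℝ × [0,1]` inside the plane. -/
def stripS : Set (ℝ × ℝ) := {p | p.2 ∈ Set.Icc (0:ℝ) 1}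

/-- A positive twist map: a `C¹` diffeomorphism of the annulus, isotopic to the identity,
whose lift `F` to the strip (together with its inverse `G`) is continuously differentiable
and satisfies `∂(p̃₁ ∘ f̃)/∂y > 0`, i.e. the first component of `DF(z)·(0,1)` is positive. -/
structure PositiveTwistMap extends AnnulusHomeo where
  F : ℝ × ℝ → ℝ × ℝ
  F' : ℝ × ℝ → (ℝ × ℝ) →L[ℝ] (ℝ × ℝ)
  G : ℝ × ℝ → ℝ × ℝ
  G' : ℝ × ℝ → (ℝ × ℝ) →L[ℝ] (ℝ × ℝ)
  F_lift : ∀ z : StripA, F (z.1, (z.2 : ℝ)) = ((lift z).1, ((lift z).2 : ℝ))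
  G_lift : ∀ z : StripA, G (z.1, (z.2 : ℝ)) = ((lift.symm z).1, ((lift.symm z).2 : ℝ))
  F_hasDeriv : ∀ z ∈ stripS, HasFDerivWithinAt F (F' z) stripS z
  G_hasDeriv : ∀ z ∈ stripS, HasFDerivWithinAt G (G' z) stripS z
  F'_cont : ContinuousOn F' stripS
  G'_cont : ContinuousOn G' stripS
  twist_pos : ∀ z ∈ stripS, 0 < (F' z (0, 1)).1

/-- The oriented angle (in `(-π, π]`) from the vertical vector `(0,1)` to the vector `w`. -/
def angleFromVertical (w : ℝ × ℝ) : ℝ := Complex.arg ⟨w.2, -w.1⟩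

/-- `ρ` is the rotation number of `f` on the boundary circle `C₀`, computed with the lift. -/
def HasRotNum0 (h : AnnulusHomeo) (ρ : ℝ) : Prop :=
  ∀ x : ℝ, Tendsto (fun n : ℕ => ((h.liftIter (n : ℤ) (bd0 x)).1 - x) / (n : ℝ))
    atTop (𝓝 ρ)

/-- `ρ` is the rotation number of `f` on the boundary circle `C₁`, computed with the lift. -/
def HasRotNum1 (h : AnnulusHomeo) (ρ : ℝ) : Prop :=
  ∀ x : ℝ, Tendsto (fun n : ℕ => ((h.liftIter (n : ℤ) (bd1 x)).1 - x) / (n : ℝ))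
    atTop (𝓝 ρ)

/-- A closed `f`-invariant set `X ⊆ A` is well ordered if the first projection is injective
on `X` and the lift preserves the horizontal order on `π⁻¹(X)`. -/
def IsWellOrdered (h : AnnulusHomeo) (X : Set Ann) : Prop :=
  IsClosed X ∧ h.toFun '' X = X ∧
  Set.InjOn (fun z : Ann => z.1) X ∧
  ∀ z₁ z₂ : StripA, annProj z₁ ∈ X → annProj z₂ ∈ X → z₁.1 < z₂.1 →
    (h.lift z₁).1 < (h.lift z₂).1

/-- An essential simple loop in the annulus: the range of an injective continuous map
from the circle that is not null-homotopic. -/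
def IsEssentialSimpleLoop (Γ : Set Ann) : Prop :=
  ∃ γ : C(𝕋, Ann), Function.Injective γ ∧ ¬ γ.Nullhomotopic ∧ Set.range γ = Γ

/-- `Γ` meets each vertical segment `{x} × [0,1]` in exactly one point. -/
def MeetsVerticalsOnce (Γ : Set Ann) : Prop :=
  ∀ x : 𝕋, ∃! z : Ann, z ∈ Γ ∧ z.1 = x

/-- No essential simple loop meeting each vertical segment exactly once is invariant,
except the two boundary circles. -/
def NoInvariantTransverseLoop (h : AnnulusHomeo) : Prop :=
  ∀ Γ : Set Ann, IsEssentialSimpleLoop Γ → MeetsVerticalsOnce Γ →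
    h.toFun '' Γ = Γ → Γ = C0 ∨ Γ = C1

/-- A continuum: a nonempty compact connected set. -/
def IsContinuum (X : Set Ann) : Prop := X.Nonempty ∧ IsCompact X ∧ IsPreconnected X

/-- A lower annulus: an open set homeomorphic to `𝕋 × [0,1)` containing `C₀`. -/
def IsLowerAnnulus (U : Set Ann) : Prop :=
  IsOpen U ∧ Nonempty (↥U ≃ₜ (𝕋 × ↥(Set.Ico (0:ℝ) 1))) ∧ C0 ⊆ U

/-- A lower disk: an open set homeomorphic to `ℝ × [0,1)` meeting `C₀`. -/
def IsLowerDisk (U : Set Ann) : Prop :=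
  IsOpen U ∧ Nonempty (↥U ≃ₜ (ℝ × ↥(Set.Ico (0:ℝ) 1))) ∧ (U ∩ C0).Nonempty

/-- A lower annulus is regular if it is a connected component of the complement of an
essential simple loop. -/
def IsRegularLowerAnnulus (U : Set Ann) : Prop :=
  ∃ Γ : Set Ann, IsEssentialSimpleLoop Γ ∧ ∃ z : Ann, U = connectedComponentIn Γᶜ z

/-- A lower disk is regular if it is a connected component of the complement of a simple
arc joining two points of `C₀` and meeting `C₀` only at its endpoints, or of the
complement of an essential simple loop meeting `C₀` in exactly one point. -/
def IsRegularLowerDisk (U : Set Ann) : Prop :=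
  (∃ a : C(↥(Set.Icc (0:ℝ) 1), Ann), Function.Injective a ∧
      (∀ t : ↥(Set.Icc (0:ℝ) 1), a t ∈ C0 ↔ ((t : ℝ) = 0 ∨ (t : ℝ) = 1)) ∧
      ∃ z : Ann, U = connectedComponentIn (Set.range a)ᶜ z) ∨
  (∃ Γ : Set Ann, IsEssentialSimpleLoop Γ ∧ (∃! z : Ann, z ∈ Γ ∩ C0) ∧
      ∃ z : Ann, U = connectedComponentIn Γᶜ z)

end

/-- The closed unit interval, as a type. -/
abbrev UI : Type := ↥(Set.Icc (0:ℝ) 1)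

/-- A lifted area-preserving twist homeomorphism without essential invariant graph: the
properties of the map that are used in the construction of connecting orbits. -/
structure TwistSys where
  f : Ann ≃ₜ Ann
  F : StripA ≃ₜ StripA
  proj : ∀ z, annProj (F z) = f (annProj z)
  deck : ∀ z, F (deckT z) = deckT (F z)
  bot : ∀ z, (F z).2 = 0 ↔ z.2 = 0
  top : ∀ z, (F z).2 = 1 ↔ z.2 = 1
  mono_bot : ∀ x x' : ℝ, x < x' → (F (x, 0)).1 < (F (x', 0)).1
  mono_top : ∀ x x' : ℝ, x < x' → (F (x, 1)).1 < (F (x', 1)).1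
  twist : ∀ (x : ℝ) (a b : UI), a < b → (F (x, a)).1 < (F (x, b)).1
  twist_symm : ∀ (x : ℝ) (a b : UI), a < b → (F.symm (x, b)).1 < (F.symm (x, a)).1
  area : MeasurePreserving f volume volume
  noGraph : ∀ ψ : 𝕋 → ℝ, Continuous ψ → (∀ x : 𝕋, ψ x ∈ Set.Icc (0:ℝ) 1) →
      f '' {z : Ann | (z.2 : ℝ) = ψ z.1} = {z : Ann | (z.2 : ℝ) = ψ z.1} →
      {z : Ann | (z.2 : ℝ) = ψ z.1} = C0 ∨ {z : Ann | (z.2 : ℝ) = ψ z.1} = C1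

/-- The reflection `(x, y) ↦ (-x, y)` of the annulus. -/
noncomputable def annFlipX : Ann ≃ₜ Ann := (Homeomorph.neg 𝕋).prodCongr (Homeomorph.refl _)

/-- The reflection `(x, y) ↦ (-x, y)` of the strip. -/
def stripFlipX : StripA ≃ₜ StripA := (Homeomorph.neg ℝ).prodCongr (Homeomorph.refl _)

/-- The reflection `(x, y) ↦ (x, 1 - y)` of the annulus. -/
def annFlipY : Ann ≃ₜ Ann := (Homeomorph.refl _).prodCongr unitInterval.symmHomeomorph

/-- The reflection `(x, y) ↦ (x, 1 - y)` of the strip. -/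
def stripFlipY : StripA ≃ₜ StripA := (Homeomorph.refl _).prodCongr unitInterval.symmHomeomorph

@[simp] lemma annFlipX_apply (z : Ann) : annFlipX z = (-z.1, z.2) := rfl
@[simp] lemma annFlipX_symm : annFlipX.symm = annFlipX := rfl
@[simp] lemma stripFlipX_apply (z : StripA) : stripFlipX z = (-z.1, z.2) := rfl
@[simp] lemma stripFlipX_symm : stripFlipX.symm = stripFlipX := rfl
@[simp] lemma annFlipY_apply (z : Ann) : annFlipY z = (z.1, unitInterval.symm z.2) := rfl
@[simp] lemma annFlipY_symm : annFlipY.symm = annFlipY := rfl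
@[simp] lemma stripFlipY_apply (z : StripA) : stripFlipY z = (z.1, unitInterval.symm z.2) := rfl
@[simp] lemma stripFlipY_symm : stripFlipY.symm = stripFlipY := rfl

lemma measurePreserving_annFlipX : MeasurePreserving annFlipX volume volume :=
  (Measure.measurePreserving_neg (volume : Measure 𝕋)).prod (MeasurePreserving.id _)

lemma measurePreserving_annFlipY : MeasurePreserving annFlipY volume volume :=
  (MeasurePreserving.id (volume : Measure 𝕋)).prod unitInterval.measurePreserving_symm

lemma annProj_flipX (z : StripA) : annProj (stripFlipX z) = annFlipX (annProj z) := by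
  simp [annProj]

lemma annProj_flipY (z : StripA) : annProj (stripFlipY z) = annFlipY (annProj z) := by
  simp [annProj]

lemma mem_C0 {z : Ann} : z ∈ C0 ↔ z.2 = 0 := by
  exact ⟨fun h => Subtype.ext h, fun h => congrArg Subtype.val h⟩

lemma mem_C1 {z : Ann} : z ∈ C1 ↔ z.2 = 1 := by
  exact ⟨fun h => Subtype.ext h, fun h => congrArg Subtype.val h⟩

namespace TwistSys

variable (S : TwistSys)

lemma proj_symm (z : StripA) : annProj (S.F.symm z) = S.f.symm (annProj z) := by
  rw [Homeomorph.eq_symm_apply, ← S.proj, S.F.apply_symm_apply]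

lemma deck_symm (z : StripA) : S.F.symm (deckT z) = deckT (S.F.symm z) := by
  rw [Homeomorph.symm_apply_eq, S.deck, S.F.apply_symm_apply]

lemma bot_symm (z : StripA) : (S.F.symm z).2 = 0 ↔ z.2 = 0 := by
  rw [← S.bot, S.F.apply_symm_apply]

lemma top_symm (z : StripA) : (S.F.symm z).2 = 1 ↔ z.2 = 1 := by
  rw [← S.top, S.F.apply_symm_apply]

lemma mono_bot_symm (x x' : ℝ) (h : x < x') : (S.F.symm (x, 0)).1 < (S.F.symm (x', 0)).1 := by
  have key : ∀ x : ℝ, S.F ((S.F.symm (x, 0)).1, 0) = (x, 0) := fun x => by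
    have h0 : (S.F.symm (x, 0)).2 = 0 := (S.bot_symm (x, 0)).2 rfl
    have e : ((S.F.symm (x, 0)).1, (0 : UI)) = S.F.symm (x, 0) := Prod.ext rfl h0.symm
    rw [e, S.F.apply_symm_apply]
  by_contra! hc
  rcases hc.eq_or_lt with hc | hc
  · have := key x
    rw [← hc, key x'] at this
    exact h.ne' (congrArg Prod.fst this)
  · have := S.mono_bot _ _ hc
    rw [key, key] at this
    exact lt_asymm h this

lemma mono_top_symm (x x' : ℝ) (h : x < x') : (S.F.symm (x, 1)).1 < (S.F.symm (x', 1)).1 := by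
  have key : ∀ x : ℝ, S.F ((S.F.symm (x, 1)).1, 1) = (x, 1) := fun x => by
    have h0 : (S.F.symm (x, 1)).2 = 1 := (S.top_symm (x, 1)).2 rfl
    have e : ((S.F.symm (x, 1)).1, (1 : UI)) = S.F.symm (x, 1) := Prod.ext rfl h0.symm
    rw [e, S.F.apply_symm_apply]
  by_contra! hc
  rcases hc.eq_or_lt with hc | hc
  · have := key x
    rw [← hc, key x'] at this
    exact h.ne' (congrArg Prod.fst this)
  · have := S.mono_top _ _ hc
    rw [key, key] at this
    exact lt_asymm h this

lemma ann_bot (a : Ann) : (S.f a).2 = 0 ↔ a.2 = 0 := by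
  obtain ⟨x, hx⟩ := QuotientAddGroup.mk_surjective a.1
  have := S.bot (x, a.2)
  have h2 := S.proj (x, a.2)
  have h3 : annProj (x, a.2) = a := Prod.ext hx rfl
  rw [h3] at h2
  rw [← h2]; exact this

lemma ann_top (a : Ann) : (S.f a).2 = 1 ↔ a.2 = 1 := by
  obtain ⟨x, hx⟩ := QuotientAddGroup.mk_surjective a.1
  have := S.top (x, a.2)
  have h2 := S.proj (x, a.2)
  have h3 : annProj (x, a.2) = a := Prod.ext hx rfl
  rw [h3] at h2
  rw [← h2]; exact this

/-- The conjugate of the inverse by `(x, y) ↦ (-x, y)`, which is again a positive twist. -/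
noncomputable def refl : TwistSys where
  f := annFlipX.trans (S.f.symm.trans annFlipX)
  F := stripFlipX.trans (S.F.symm.trans stripFlipX)
  proj z := by
    simp only [Homeomorph.trans_apply, annProj_flipX, proj_symm]
  deck z := by
    simp only [Homeomorph.trans_apply]
    have h : deckT (stripFlipX (deckT z)) = stripFlipX z := by
      ext <;> simp [deckT]
    have h2 := S.deck_symm (stripFlipX (deckT z))
    rw [h] at h2
    rw [h2]
    ext <;> simp [deckT]
  bot z := S.bot_symm _
  top z := S.top_symm _
  mono_bot x x' h := by
    simpa using S.mono_bot_symm (-x') (-x) (by linarith)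
  mono_top x x' h := by
    simpa using S.mono_top_symm (-x') (-x) (by linarith)
  twist x a b h := by
    simpa using S.twist_symm (-x) a b h
  twist_symm x a b h := by
    have := S.twist (-x) a b h
    show -(S.F (-x, b)).1 < -(S.F (-x, a)).1
    linarith
  area := (measurePreserving_annFlipX.comp
    (S.area.symm S.f.toMeasurableEquiv)).comp measurePreserving_annFlipX
  noGraph ψ hψ h01 hinv := by
    have hs : ∀ ψ' : 𝕋 → ℝ, annFlipX ⁻¹' {z : Ann | (z.2 : ℝ) = ψ' z.1} =
      {z : Ann | (z.2 : ℝ) = ψ' (-z.1)} := fun _ => rfl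
    have key : annFlipX ⁻¹' {z : Ann | (z.2 : ℝ) = ψ z.1} = C0 ∨
        annFlipX ⁻¹' {z : Ann | (z.2 : ℝ) = ψ z.1} = C1 := by
      rw [hs]
      refine S.noGraph (fun x => ψ (-x)) (hψ.comp continuous_neg) (fun x => h01 _) ?_
      rw [← hs]
      rw [← Homeomorph.image_symm, annFlipX_symm]
      set Γ := {z : Ann | (z.2 : ℝ) = ψ z.1}
      have e := congrArg (fun s => S.f '' (annFlipX '' s)) hinv
      simp only [image_image, Homeomorph.trans_apply] at e
      have i2 : ∀ z : Ann, annFlipX (annFlipX z) = z := fun z => by simp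
      simp only [i2, S.f.apply_symm_apply] at e
      rw [image_image]
      exact e.symm
    rcases key with h | h
    · left
      rw [preimage_eq_iff_eq_image annFlipX.bijective] at h
      rw [h, ← annFlipX_symm, Homeomorph.image_symm]; rfl
    · right
      rw [preimage_eq_iff_eq_image annFlipX.bijective] at h
      rw [h, ← annFlipX_symm, Homeomorph.image_symm]; rfl

/-- The conjugate of the inverse by `(x, y) ↦ (x, 1 - y)`, which is again a positive twist. -/
noncomputable def dual : TwistSys where
  f := annFlipY.trans (S.f.symm.trans annFlipY)
  F := stripFlipY.trans (S.F.symm.trans stripFlipY)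
  proj z := by
    simp only [Homeomorph.trans_apply, annProj_flipY, proj_symm]
  deck z := by
    simp only [Homeomorph.trans_apply]
    have h : stripFlipY (deckT z) = deckT (stripFlipY z) := rfl
    rw [h, S.deck_symm]; rfl
  bot z := by
    have := S.top_symm (stripFlipY z)
    simpa using this
  top z := by
    have := S.bot_symm (stripFlipY z)
    simpa using this
  mono_bot x x' h := by simpa using S.mono_top_symm x x' h
  mono_top x x' h := by simpa using S.mono_bot_symm x x' h
  twist x a b h := by
    simpa using S.twist_symm x _ _ (unitInterval.strictAnti_symm h)
  twist_symm x a b h := by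
    exact S.twist x _ _ (unitInterval.strictAnti_symm h)
  area := (measurePreserving_annFlipY.comp
    (S.area.symm S.f.toMeasurableEquiv)).comp measurePreserving_annFlipY
  noGraph ψ hψ h01 hinv := by
    have hs : annFlipY ⁻¹' {z : Ann | (z.2 : ℝ) = ψ z.1} =
      {z : Ann | (z.2 : ℝ) = 1 - ψ z.1} := by
        ext z; simp only [mem_preimage, annFlipY_apply, mem_ofPred_eq, unitInterval.coe_symm_eq]
        constructor <;> intro h <;> linarith
    have key : annFlipY ⁻¹' {z : Ann | (z.2 : ℝ) = ψ z.1} = C0 ∨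
        annFlipY ⁻¹' {z : Ann | (z.2 : ℝ) = ψ z.1} = C1 := by
      rw [hs]
      refine S.noGraph (fun x => 1 - ψ x) (continuous_const.sub hψ)
        (fun x => ⟨by linarith [(h01 x).2], by linarith [(h01 x).1]⟩) ?_
      rw [← hs]
      rw [← Homeomorph.image_symm, annFlipY_symm]
      set Γ := {z : Ann | (z.2 : ℝ) = ψ z.1}
      have e := congrArg (fun s => S.f '' (annFlipY '' s)) hinv
      simp only [image_image, Homeomorph.trans_apply] at e
      have i2 : ∀ z : Ann, annFlipY (annFlipY z) = z := fun z => by simp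
      simp only [i2, S.f.apply_symm_apply] at e
      rw [image_image]
      exact e.symm
    rcases key with h | h
    · right
      rw [preimage_eq_iff_eq_image annFlipY.bijective] at h
      rw [h, ← annFlipY_symm, Homeomorph.image_symm]
      ext z; simp [mem_C0, mem_C1]
    · left
      rw [preimage_eq_iff_eq_image annFlipY.bijective] at h
      rw [h, ← annFlipY_symm, Homeomorph.image_symm]
      ext z; simp [mem_C0, mem_C1]

lemma refl_f (z : Ann) : S.refl.f z = annFlipX (S.f.symm (annFlipX z)) := rfl
lemma refl_F (z : StripA) : S.refl.F z = stripFlipX (S.F.symm (stripFlipX z)) := rfl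
lemma dual_f (z : Ann) : S.dual.f z = annFlipY (S.f.symm (annFlipY z)) := rfl
lemma dual_F (z : StripA) : S.dual.F z = stripFlipY (S.F.symm (stripFlipY z)) := rfl
lemma refl_f_symm (z : Ann) : S.refl.f.symm z = annFlipX (S.f (annFlipX z)) := rfl
lemma dual_f_symm (z : Ann) : S.dual.f.symm z = annFlipY (S.f (annFlipY z)) := rfl

end TwistSys

open scoped unitInterval

/-- `θ` is an angle of the complex number `e`. -/
def IsAng (e : ℂ) (θ : ℝ) : Prop := e.re = ‖e‖ * Real.cos θ ∧ e.im = ‖e‖ * Real.sin θ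

namespace IsAng

variable {e e' : ℂ} {θ θ' : ℝ}

lemma cos_pos_iff (h : IsAng e θ) (he : e ≠ 0) : 0 < Real.cos θ ↔ 0 < e.re := by
  rw [h.1]; exact (mul_pos_iff_of_pos_left (norm_pos_iff.2 he)).symm

lemma sin_pos_iff (h : IsAng e θ) (he : e ≠ 0) : 0 < Real.sin θ ↔ 0 < e.im := by
  rw [h.2]; exact (mul_pos_iff_of_pos_left (norm_pos_iff.2 he)).symm

lemma cos_neg_iff (h : IsAng e θ) (he : e ≠ 0) : Real.cos θ < 0 ↔ e.re < 0 := by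
  rw [h.1]
  exact ⟨mul_neg_of_pos_of_neg (norm_pos_iff.2 he),
    fun h => (pos_iff_neg_of_mul_neg h).1 (norm_pos_iff.2 he)⟩

lemma sin_neg_iff (h : IsAng e θ) (he : e ≠ 0) : Real.sin θ < 0 ↔ e.im < 0 := by
  rw [h.2]
  exact ⟨mul_neg_of_pos_of_neg (norm_pos_iff.2 he),
    fun h => (pos_iff_neg_of_mul_neg h).1 (norm_pos_iff.2 he)⟩

lemma cos_sub_eq_one (h : IsAng e θ) (h' : IsAng e θ') (he : e ≠ 0) :
    Real.cos (θ - θ') = 1 := by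
  have hn := norm_pos_iff.2 he
  have hc : Real.cos θ = Real.cos θ' := mul_left_cancel₀ hn.ne' (h.1.symm.trans h'.1)
  have hs : Real.sin θ = Real.sin θ' := mul_left_cancel₀ hn.ne' (h.2.symm.trans h'.2)
  rw [Real.cos_sub, hc, hs]
  nlinarith [Real.sin_sq_add_cos_sq θ']

lemma eq_of_lt (h : IsAng e θ) (h' : IsAng e θ') (he : e ≠ 0)
    (h1 : -(2 * Real.pi) < θ - θ') (h2 : θ - θ' < 2 * Real.pi) : θ = θ' := by
  have := (Real.cos_eq_one_iff_of_lt_of_lt h1 h2).1 (h.cos_sub_eq_one h' he)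
  linarith

lemma add_arg (h : IsAng e θ) (he : e ≠ 0) : IsAng e' (θ + (e' / e).arg) := by
  have hn := norm_pos_iff.2 he
  have hn' := hn.ne'
  have e1 : e' = e' / e * e := (div_mul_cancel₀ _ he).symm
  have h1 := Complex.norm_mul_cos_arg (e' / e)
  have h2 := Complex.norm_mul_sin_arg (e' / e)
  have hN : ‖e'‖ = ‖e' / e‖ * ‖e‖ := by rw [← norm_mul, ← e1]
  have hre : e'.re = (e' / e).re * e.re - (e' / e).im * e.im := by
    rw [← Complex.mul_re, ← e1]
  have him : e'.im = (e' / e).re * e.im + (e' / e).im * e.re := by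
    rw [← Complex.mul_im, ← e1]
  constructor
  · rw [hre, hN, ← h1, ← h2, h.1, h.2, Real.cos_add]; ring
  · rw [him, hN, ← h1, ← h2, h.1, h.2, Real.sin_add]; ring

lemma neg_swap (h : IsAng e θ) : IsAng ⟨-e.im, -e.re⟩ (3 * Real.pi / 2 - θ) := by
  have hn : ‖(⟨-e.im, -e.re⟩ : ℂ)‖ = ‖e‖ := by
    rw [Complex.norm_def, Complex.norm_def, Complex.normSq_apply, Complex.normSq_apply]
    congr 1; simp; ring
  have h1 : Real.cos (3 * Real.pi / 2 - θ) = - Real.sin θ := by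
    rw [show 3 * Real.pi / 2 - θ = (Real.pi / 2 - θ) + Real.pi by ring, Real.cos_add_pi,
      Real.cos_pi_div_two_sub]
  have h2 : Real.sin (3 * Real.pi / 2 - θ) = - Real.cos θ := by
    rw [show 3 * Real.pi / 2 - θ = (Real.pi / 2 - θ) + Real.pi by ring, Real.sin_add_pi,
      Real.sin_pi_div_two_sub]
  refine ⟨?_, ?_⟩
  · rw [hn, h1, h.2]; simp
  · rw [hn, h2, h.1]; simp

end IsAng

/-- The angle in `(0, 3π/2)` of a complex number outside the closed fourth quadrant. -/
noncomputable def startAng (e : ℂ) : ℝ := 3 * Real.pi / 4 + (e / ⟨-1, 1⟩).arg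

lemma isAng_diag : IsAng ⟨-1, 1⟩ (3 * Real.pi / 4) := by
  have h1 : Real.cos (3 * Real.pi / 4) = - (√2 / 2) := by
    rw [show 3 * Real.pi / 4 = Real.pi - Real.pi / 4 by ring, Real.cos_pi_sub,
      Real.cos_pi_div_four]
  have h2 : Real.sin (3 * Real.pi / 4) = √2 / 2 := by
    rw [show 3 * Real.pi / 4 = Real.pi - Real.pi / 4 by ring, Real.sin_pi_sub,
      Real.sin_pi_div_four]
  have hn : ‖(⟨-1, 1⟩ : ℂ)‖ = √2 := by
    rw [Complex.norm_def, Complex.normSq_apply]; norm_num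
  have h3 : √2 * √2 = 2 := Real.mul_self_sqrt (by norm_num)
  refine ⟨?_, ?_⟩
  · rw [hn, h1]; simp; linarith
  · rw [hn, h2]; simp; linarith

lemma isAng_startAng (e : ℂ) : IsAng e (startAng e) :=
  isAng_diag.add_arg (fun h => by simpa using congrArg Complex.re h)

lemma slit_of_start {e : ℂ} (h : 0 < e.im ∨ e.re < 0) : e / ⟨-1, 1⟩ ∈ Complex.slitPlane := by
  rw [Complex.mem_slitPlane_iff, Complex.div_re, Complex.div_im]
  simp only [Complex.normSq_apply]
  norm_num
  by_cases hc : e.re + e.im = 0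
  · left; rcases h with h | h <;> linarith
  · right; intro h'; apply hc; linarith

lemma startAng_mem {e : ℂ} (h : 0 < e.im ∨ e.re < 0) :
    startAng e ∈ Ioo 0 (3 * Real.pi / 2) := by
  have he : e ≠ 0 := by rintro rfl; simp at h
  have ha := isAng_startAng e
  have hπ := Real.pi_pos
  have h1 := Complex.neg_pi_lt_arg (e / ⟨-1, 1⟩)
  have h2 : (e / ⟨-1, 1⟩).arg < Real.pi :=
    lt_of_le_of_ne (Complex.arg_le_pi _) (Complex.mem_slitPlane_iff_arg.1 (slit_of_start h)).1
  constructor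
  · by_contra! hc
    have hlow : -(Real.pi / 4) < startAng e := by unfold startAng; linarith
    have c1 : 0 < Real.cos (startAng e) := Real.cos_pos_of_mem_Ioo ⟨by linarith, by linarith⟩
    have c2 : Real.sin (startAng e) ≤ 0 :=
      Real.sin_nonpos_of_nonpos_of_neg_pi_le hc (by linarith)
    rcases h with h | h
    · exact absurd ((ha.sin_pos_iff he).2 h) (by linarith)
    · exact absurd ((ha.cos_neg_iff he).2 h) (by linarith)
  · by_contra! hc
    have hlow : startAng e < 7 * Real.pi / 4 := by unfold startAng; linarith
    have c1 : 0 ≤ Real.cos (startAng e) := by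
      rw [← Real.cos_sub_two_pi]
      exact Real.cos_nonneg_of_mem_Icc ⟨by linarith, by linarith⟩
    have c2 : Real.sin (startAng e) ≤ 0 := by
      rw [← Real.sin_sub_two_pi]
      exact Real.sin_nonpos_of_nonpos_of_neg_pi_le (by linarith) (by linarith)
    rcases h with h | h
    · exact absurd ((ha.sin_pos_iff he).2 h) (by linarith)
    · exact absurd ((ha.cos_neg_iff he).2 h) (by linarith)

lemma continuousAt_startAng {e : ℂ} (h : 0 < e.im ∨ e.re < 0) : ContinuousAt startAng e := by
  unfold startAng
  refine continuousAt_const.add ?_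
  have h1 : ContinuousAt (fun e : ℂ => e / ⟨-1, 1⟩) e := (continuous_id.div_const _).continuousAt
  exact ContinuousAt.comp' (Complex.continuousAt_arg (slit_of_start h)) h1

/-- Angles lift along homotopies of non-zero complex numbers. -/
lemma exists_lift_homotopy {A : Type*} [TopologicalSpace A] (H : C(I × A, ℂ))
    (hH : ∀ x, H x ≠ 0) (g : C(A, ℝ)) (hg : ∀ a, IsAng (H (0, a)) (g a)) :
    ∃ L : C(I × A, ℝ), (∀ x, IsAng (H x) (L x)) ∧ ∀ a, L (0, a) = g a := by
  have hmem : ∀ x, H x / (‖H x‖ : ℂ) ∈ Submonoid.unitSphere ℂ := fun x => by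
    simp [Submonoid.unitSphere, norm_ne_zero_iff.2 (hH x)]
  let H' : C(I × A, Circle) := ⟨fun x => ⟨H x / (‖H x‖ : ℂ), hmem x⟩, by
    refine Continuous.subtype_mk ?_ _
    refine H.continuous.div (Complex.continuous_ofReal.comp H.continuous.norm) fun x => ?_
    exact_mod_cast norm_ne_zero_iff.2 (hH x)⟩
  have key : ∀ x (θ : ℝ), H' x = Circle.exp θ ↔ IsAng (H x) θ := fun x θ => by
    have hn := norm_ne_zero_iff.2 (hH x)
    have e : H' x = Circle.exp θ ↔ H x / (‖H x‖ : ℂ) = Circle.exp θ := Subtype.ext_iff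
    rw [e]
    rw [Circle.coe_exp, div_eq_iff (by exact_mod_cast hn), mul_comm, Complex.ext_iff]
    simp only [Complex.re_ofReal_mul, Complex.im_ofReal_mul, Complex.exp_ofReal_mul_I_re,
      Complex.exp_ofReal_mul_I_im]
    rfl
  have h0 : ∀ a, H' (0, a) = Circle.exp (g a) := fun a => (key _ _).2 (hg a)
  refine ⟨Circle.isCoveringMap_exp.liftHomotopy H' g h0, fun x => ?_,
    Circle.isCoveringMap_exp.liftHomotopy_zero H' g h0⟩
  exact (key _ _).1 (congrFun (Circle.isCoveringMap_exp.liftHomotopy_lifts H' g h0) x).symm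

lemma exists_lift_path (h : C(I, ℂ)) (hh : ∀ x, h x ≠ 0) (θ : ℝ) (hθ : IsAng (h 0) θ) :
    ∃ L : C(I, ℝ), (∀ x, IsAng (h x) (L x)) ∧ L 0 = θ := by
  obtain ⟨L, hL, h0⟩ := exists_lift_homotopy (A := Unit) (h.comp ⟨Prod.fst, continuous_fst⟩)
    (fun x => hh _) (ContinuousMap.const _ θ) (fun _ => hθ)
  exact ⟨L.comp ⟨fun s => (s, ()), by fun_prop⟩, fun x => hL (x, ()), h0 ()⟩

/-- A continuous function on a preconnected set which starts between two avoided values stays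
between them. -/
lemma mem_Ioo_of_avoid {X : Type*} [TopologicalSpace X] {s : Set X} (hs : IsPreconnected s)
    {g : X → ℝ} (hg : ContinuousOn g s) {a b : ℝ} {x0 : X} (hx0 : x0 ∈ s)
    (h0 : g x0 ∈ Ioo a b) (hav : ∀ x ∈ s, g x ≠ a ∧ g x ≠ b) {x : X} (hx : x ∈ s) :
    g x ∈ Ioo a b := by
  have hc := (hs.image g hg).ordConnected
  by_contra hn
  simp only [mem_Ioo, not_and_or, not_lt] at hn
  rcases hn with hn | hn
  · obtain ⟨y, hy, e⟩ := hc.out (mem_image_of_mem g hx) (mem_image_of_mem g hx0) ⟨hn, h0.1.le⟩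
    exact (hav y hy).1 e
  · obtain ⟨y, hy, e⟩ := hc.out (mem_image_of_mem g hx0) (mem_image_of_mem g hx) ⟨h0.2.le, hn⟩
    exact (hav y hy).2 e

/-- Two angle functions along a path that agree at the start agree everywhere. -/
lemma lift_unique {h : I → ℂ} (hh : ∀ x, h x ≠ 0) {L M : I → ℝ} (hL : Continuous L)
    (hM : Continuous M) (aL : ∀ x, IsAng (h x) (L x)) (aM : ∀ x, IsAng (h x) (M x))
    (h0 : L 0 = M 0) (x : I) : L x = M x := by
  have hπ := Real.pi_pos
  have key := mem_Ioo_of_avoid (s := univ) (g := fun x => L x - M x) (a := -Real.pi)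
    (b := Real.pi) isPreconnected_univ (hL.sub hM).continuousOn (mem_univ 0)
    (by simp [h0, hπ]) (fun x _ => by
      have := (aL x).cos_sub_eq_one (aM x) (hh x)
      constructor <;> intro hc <;> rw [hc] at this <;> simp at this <;> linarith) (mem_univ x)
  exact (aL x).eq_of_lt (aM x) (hh x) (by linarith [key.1]) (by linarith [key.2])

/-- If the vector `(q, r)` is never antiparallel to `(q, -p)`, then neither are their angles. -/
lemma ang_step_ne {p q r θ θ' : ℝ} (h : IsAng ⟨p, q⟩ θ) (h' : IsAng ⟨q, r⟩ θ')
    (he : (⟨p, q⟩ : ℂ) ≠ 0) (he' : (⟨q, r⟩ : ℂ) ≠ 0) (hpr : q = 0 → p * r ≤ 0) :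
    θ' - θ + Real.pi / 2 ≠ -Real.pi ∧ θ' - θ + Real.pi / 2 ≠ Real.pi := by
  have hn := norm_pos_iff.2 he
  have hn' := norm_pos_iff.2 he'
  have key : ¬ (Real.cos θ' = - Real.sin θ ∧ Real.sin θ' = Real.cos θ) := by
    rintro ⟨h1, h2⟩
    have a1 := h.1; have a2 := h.2; have b1 := h'.1; have b2 := h'.2
    simp only at a1 a2 b1 b2
    rw [h1] at b1
    rw [h2] at b2
    have hs : Real.sin θ = 0 := by
      have : (‖(⟨p, q⟩ : ℂ)‖ + ‖(⟨q, r⟩ : ℂ)‖) * Real.sin θ = 0 := by linarith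
      rcases mul_eq_zero.1 this with h | h
      · linarith
      · exact h
    have hq : q = 0 := by rw [a2, hs, mul_zero]
    have hc : Real.cos θ ^ 2 = 1 := by have := Real.sin_sq_add_cos_sq θ; rw [hs] at this; linarith
    have := hpr hq
    rw [b2] at this
    rw [a1] at this
    nlinarith [mul_pos hn hn', hn.le]
  constructor
  · intro hc
    have : θ' = θ - Real.pi / 2 - Real.pi := by linarith
    apply key
    rw [this, Real.cos_sub_pi, Real.sin_sub_pi, Real.cos_sub_pi_div_two, Real.sin_sub_pi_div_two]
    simp
  · intro hc
    have : θ' = θ - Real.pi / 2 + Real.pi := by linarith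
    apply key
    rw [this, Real.cos_add_pi, Real.sin_add_pi, Real.cos_sub_pi_div_two, Real.sin_sub_pi_div_two]
    simp

lemma ang_step_start {p q r θ θ' : ℝ} (h : IsAng ⟨p, q⟩ θ) (h' : IsAng ⟨q, r⟩ θ')
    (he : (⟨p, q⟩ : ℂ) ≠ 0) (he' : (⟨q, r⟩ : ℂ) ≠ 0) (hθ : θ ∈ Ioo 0 (3 * Real.pi / 2))
    (hθ' : θ' ∈ Ioo 0 (3 * Real.pi / 2)) (hne : θ' - θ + Real.pi / 2 ≠ Real.pi) :
    θ' - θ + Real.pi / 2 ∈ Ioo (-Real.pi) Real.pi := by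
  have hπ := Real.pi_pos
  refine ⟨by linarith [hθ.2, hθ'.1], lt_of_le_of_ne ?_ hne⟩
  by_contra! hc
  have h1 := (h.sin_pos_iff he).1 (Real.sin_pos_of_pos_of_lt_pi hθ.1 (by linarith [hθ'.2]))
  have h2 := (h'.cos_neg_iff he').1 (Real.cos_neg_of_pi_div_two_lt_of_lt
    (by linarith [hθ.1]) (by linarith [hθ'.2]))
  simp only at h1 h2
  linarith

lemma ang_step_low {p q r θ θ' : ℝ} (h : IsAng ⟨p, q⟩ θ) (h' : IsAng ⟨q, r⟩ θ')
    (he : (⟨p, q⟩ : ℂ) ≠ 0) (he' : (⟨q, r⟩ : ℂ) ≠ 0)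
    (hs : θ' - θ + Real.pi / 2 ∈ Ioo (-Real.pi) Real.pi) (hθ : θ ≤ -(Real.pi / 2)) :
    θ' < -(Real.pi / 2) := by
  have hπ := Real.pi_pos
  rcases le_or_gt θ (-Real.pi) with h1 | h1
  · linarith [hs.2]
  · by_contra! hc
    have hq : q < 0 := (h.sin_neg_iff he).1 (Real.sin_neg_of_neg_of_neg_pi_lt (by linarith) h1)
    have := (h'.cos_neg_iff he').2 hq
    exact absurd this (not_lt.2 (Real.cos_nonneg_of_mem_Icc ⟨by linarith, by linarith [hs.2]⟩))

lemma ang_step_high {p q r θ θ' : ℝ} (h : IsAng ⟨p, q⟩ θ) (h' : IsAng ⟨q, r⟩ θ')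
    (he : (⟨p, q⟩ : ℂ) ≠ 0) (he' : (⟨q, r⟩ : ℂ) ≠ 0)
    (hs : θ' - θ + Real.pi / 2 ∈ Ioo (-Real.pi) Real.pi) (hθ : 3 * Real.pi / 2 ≤ θ') :
    3 * Real.pi / 2 < θ := by
  have hπ := Real.pi_pos
  by_contra! hc
  have h1 : Real.pi < θ := by linarith [hs.2]
  have hq : q < 0 := by
    refine (h.sin_neg_iff he).1 ?_
    rw [← Real.sin_sub_two_pi]
    exact Real.sin_neg_of_neg_of_neg_pi_lt (by linarith) (by linarith)
  have := (h'.cos_neg_iff he').2 hq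
  rw [← Real.cos_sub_two_pi] at this
  exact absurd this (not_lt.2 (Real.cos_nonneg_of_mem_Icc ⟨by linarith, by linarith [hs.2]⟩))

namespace TwistSys

variable (S : TwistSys)

/-- The complex number recording the horizontal displacements of a pair of points and of the
image of the pair. -/
noncomputable def disp (z w : StripA) : ℂ := ⟨z.1 - w.1, (S.F z).1 - (S.F w).1⟩

lemma continuous_disp : Continuous fun x : StripA × StripA => S.disp x.1 x.2 := by
  have h : (fun x : StripA × StripA => S.disp x.1 x.2) = fun x =>
      ((x.1.1 - x.2.1 : ℝ) : ℂ) + (((S.F x.1).1 - (S.F x.2).1 : ℝ) : ℂ) * Complex.I := by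
    ext x; apply Complex.ext <;> simp [disp]
  rw [h]
  fun_prop

lemma disp_ne_zero {z w : StripA} (h : z ≠ w) : S.disp z w ≠ 0 := by
  intro hc
  have h1 : z.1 - w.1 = 0 := congrArg Complex.re hc
  have h2 : (S.F z).1 - (S.F w).1 = 0 := congrArg Complex.im hc
  obtain ⟨x, a⟩ := z
  obtain ⟨x', b⟩ := w
  obtain rfl : x = x' := by simp at h1; linarith
  rcases lt_trichotomy a b with hab | rfl | hab
  · linarith [S.twist x _ _ hab]
  · exact h rfl
  · linarith [S.twist x _ _ hab]

lemma twist_le (x : ℝ) {a b : UI} (h : a ≤ b) : (S.F (x, a)).1 ≤ (S.F (x, b)).1 := by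
  rcases h.eq_or_lt with rfl | h
  · exact le_rfl
  · exact (S.twist x a b h).le

lemma disp_start {z w : StripA} (h : z ≠ w) (hb : z.2 = 1 ∨ w.2 = 0) :
    0 < (S.disp z w).im ∨ (S.disp z w).re < 0 := by
  obtain ⟨x, a⟩ := z
  obtain ⟨x', b⟩ := w
  simp only [disp, sub_pos, sub_neg]
  by_contra! hc
  obtain ⟨h1, h2⟩ := hc
  have ha : a ≤ 1 := a.2.2
  have hb' : b ≤ 1 := b.2.2
  have ha0 : 0 ≤ a := a.2.1
  have hb0 : 0 ≤ b := b.2.1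
  rcases hb with rfl | rfl
  · rcases h2.eq_or_lt with rfl | h2
    · have : b < 1 := lt_of_le_of_ne hb' fun e => h (by rw [e])
      linarith [S.twist x' _ _ this]
    · linarith [S.mono_top _ _ h2, S.twist_le x' hb']
  · rcases h2.eq_or_lt with rfl | h2
    · have : 0 < a := lt_of_le_of_ne ha0 fun e => h (by rw [← e])
      linarith [S.twist x' _ _ this]
    · linarith [S.mono_bot _ _ h2, S.twist_le x ha0]

lemma disp_step (z w : StripA) : (S.disp z w).im = 0 →
    (S.disp z w).re * (S.disp (S.F z) (S.F w)).im ≤ 0 := by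
  simp only [disp]
  intro h
  have key : ∀ u v : StripA, u.1 = v.1 →
      ((S.F.symm u).1 - (S.F.symm v).1) * ((S.F u).1 - (S.F v).1) ≤ 0 := by
    rintro ⟨x, a⟩ ⟨x', b⟩ (rfl : x = x')
    rcases lt_trichotomy a b with hab | rfl | hab
    · nlinarith [S.twist x _ _ hab, S.twist_symm x _ _ hab]
    · simp
    · nlinarith [S.twist x _ _ hab, S.twist_symm x _ _ hab]
  simpa using key (S.F z) (S.F w) (by linarith)

end TwistSys

lemma continuous_annProj : Continuous annProj :=
  ((AddCircle.continuous_mk' (1:ℝ)).comp continuous_fst).prodMk continuous_snd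

lemma isOpenMap_annProj : IsOpenMap annProj :=
  (QuotientAddGroup.isOpenMap_coe (N := AddSubgroup.zmultiples (1:ℝ))).prodMap IsOpenMap.id

lemma annProj_surjective (a : Ann) : ∃ z, annProj z = a := by
  obtain ⟨x, hx⟩ := QuotientAddGroup.mk_surjective a.1
  exact ⟨(x, a.2), Prod.ext hx rfl⟩

lemma annProj_deckZ (k : ℤ) (z : StripA) : annProj (deckZ k z) = annProj z := by
  refine Prod.ext ?_ rfl
  show ((z.1 + (k : ℝ) : ℝ) : 𝕋) = (z.1 : 𝕋)
  rw [AddCircle.coe_add, (AddCircle.coe_eq_zero_iff (1:ℝ) (x := (k:ℝ))).2 ⟨k, by simp⟩, add_zero]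

lemma annProj_eq_iff {z z' : StripA} : annProj z = annProj z' ↔ ∃ k : ℤ, z' = deckZ k z := by
  refine ⟨fun h => ?_, fun ⟨k, hk⟩ => by rw [hk, annProj_deckZ]⟩
  have h1 : ((z'.1 - z.1 : ℝ) : 𝕋) = 0 := by
    rw [AddCircle.coe_sub, sub_eq_zero]; exact (congrArg Prod.fst h).symm
  obtain ⟨k, hk⟩ := (AddCircle.coe_eq_zero_iff (1:ℝ)).1 h1
  refine ⟨k, Prod.ext ?_ (congrArg Prod.snd h).symm⟩
  simp only [zsmul_eq_mul, mul_one] at hk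
  simp [deckZ, hk]

lemma continuous_deckZ (k : ℤ) : Continuous (deckZ k) := by
  unfold deckZ; fun_prop

/-- The straight path between two points of the strip. -/
noncomputable def segPath (z z' : StripA) : Path z z' where
  toFun s := ((1 - s) * z.1 + s * z'.1, ⟨(1 - s) * z.2 + s * z'.2, by
    have h0 := s.2.1; have h1 := s.2.2
    have := z.2.2; have := z'.2.2
    exact convex_Icc (0:ℝ) 1 z.2.2 z'.2.2 (by linarith) h0 (by ring)⟩)
  continuous_toFun := by fun_prop
  source' := by ext <;> simp
  target' := by ext <;> simp

lemma segPath_apply_fst (z z' : StripA) (s : I) :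
    (segPath z z' s).1 = (1 - s) * z.1 + s * z'.1 := rfl

lemma segPath_apply_snd (z z' : StripA) (s : I) :
    ((segPath z z' s).2 : ℝ) = (1 - s) * z.2 + s * z'.2 := rfl

lemma segPath_mem_ball {z z' : StripA} {r : ℝ} (h : z' ∈ Metric.ball z r) (s : I) :
    segPath z z' s ∈ Metric.ball z r := by
  rw [Metric.mem_ball] at h ⊢
  refine lt_of_le_of_lt ?_ h
  have h0 := s.2.1; have h1 := s.2.2
  rw [Prod.dist_eq, Prod.dist_eq]
  refine max_le_max ?_ ?_
  · rw [Real.dist_eq, Real.dist_eq, segPath_apply_fst,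
      show (1 - (s:ℝ)) * z.1 + s * z'.1 - z.1 = s * (z'.1 - z.1) by ring, abs_mul,
      abs_of_nonneg h0]
    exact mul_le_of_le_one_left (abs_nonneg _) h1
  · rw [Subtype.dist_eq, Subtype.dist_eq, Real.dist_eq, Real.dist_eq, segPath_apply_snd,
      show (1 - (s:ℝ)) * z.2 + s * z'.2 - z.2 = s * (z'.2 - z.2) by ring, abs_mul,
      abs_of_nonneg h0]
    exact mul_le_of_le_one_left (abs_nonneg _) h1

/-- The points of the strip that can be joined to height `c` by a path over `N`. -/
def ReachFrom (c : UI) (N : Set Ann) : Set StripA :=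
  {z | ∃ t : StripA, t.2 = c ∧ ∃ γ : Path t z, ∀ s, annProj (γ s) ∈ N}

section reach

variable {c : UI} {N : Set Ann} {z : StripA}

lemma ReachFrom.proj_mem (h : z ∈ ReachFrom c N) : annProj z ∈ N := by
  obtain ⟨t, -, γ, hγ⟩ := h
  simpa using hγ 1

lemma reachFrom_self (hz : annProj z ∈ N) (hc : z.2 = c) : z ∈ ReachFrom c N :=
  ⟨z, hc, Path.refl z, fun s => by simpa using hz⟩

lemma ReachFrom.mono {N' : Set Ann} (hN : N ⊆ N') : ReachFrom c N ⊆ ReachFrom c N' := by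
  rintro z ⟨t, ht, γ, hγ⟩
  exact ⟨t, ht, γ, fun s => hN (hγ s)⟩

lemma path_trans_forall {X : Type*} [TopologicalSpace X] {x y w : X} {p : X → Prop}
    (γ : Path x y) (γ' : Path y w) (h : ∀ s, p (γ s)) (h' : ∀ s, p (γ' s)) (s : I) :
    p (γ.trans γ' s) := by
  rw [Path.trans_apply]; split_ifs
  · exact h _
  · exact h' _

lemma ReachFrom.extend {z' : StripA} (h : z ∈ ReachFrom c N) (γ' : Path z z')
    (h' : ∀ s, annProj (γ' s) ∈ N) : z' ∈ ReachFrom c N := by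
  obtain ⟨t, ht, γ, hγ⟩ := h
  exact ⟨t, ht, γ.trans γ', path_trans_forall (p := fun z => annProj z ∈ N) γ γ' hγ h'⟩

lemma ReachFrom.path_mem {t : StripA} (ht : t.2 = c) (γ : Path t z)
    (hγ : ∀ s, annProj (γ s) ∈ N) (s : I) : γ s ∈ ReachFrom c N :=
  ⟨t, ht, (γ.subpath 0 s).cast (by simp) rfl, fun _ => hγ _⟩

lemma ReachFrom.shift (k : ℤ) (h : z ∈ ReachFrom c N) : deckZ k z ∈ ReachFrom c N := by
  obtain ⟨t, ht, γ, hγ⟩ := h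
  exact ⟨deckZ k t, ht, γ.map (continuous_deckZ k), fun s => by
    simpa [annProj_deckZ] using hγ s⟩

lemma ReachFrom.of_proj_eq {z' : StripA} (h : z ∈ ReachFrom c N) (e : annProj z = annProj z') :
    z' ∈ ReachFrom c N := by
  obtain ⟨k, rfl⟩ := annProj_eq_iff.1 e
  exact ReachFrom.shift k h

lemma exists_ball_over (hN : IsOpen N) (hz : annProj z ∈ N) :
    ∃ r > 0, ∀ z' ∈ Metric.ball z r, annProj z' ∈ N :=
  Metric.isOpen_iff.1 (hN.preimage continuous_annProj) z hz

lemma isOpen_reachFrom (hN : IsOpen N) : IsOpen (ReachFrom c N) := by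
  rw [Metric.isOpen_iff]
  intro z hz
  obtain ⟨r, hr, hb⟩ := exists_ball_over hN (ReachFrom.proj_mem hz)
  exact ⟨r, hr, fun z' hz' =>
    ReachFrom.extend hz (segPath z z') fun s => hb _ (segPath_mem_ball hz' s)⟩

lemma isOpen_over_diff_reachFrom (hN : IsOpen N) : IsOpen (annProj ⁻¹' N \ ReachFrom c N) := by
  rw [Metric.isOpen_iff]
  rintro z ⟨hz, hz2⟩
  obtain ⟨r, hr, hb⟩ := exists_ball_over hN hz
  refine ⟨r, hr, fun z' hz' => ⟨hb z' hz', fun hc => hz2 ?_⟩⟩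
  refine ReachFrom.extend hc (segPath z z').symm fun s => hb _ ?_
  exact segPath_mem_ball hz' _

/-- Every point over a connected set containing the circle at height `c` can be joined to that
height over any neighbourhood of the set. -/
lemma mem_reachFrom_of_isPreconnected {P : Set Ann} (hP : IsPreconnected P) (hN : IsOpen N)
    (hPN : P ⊆ N) (hc : ∀ a : Ann, a.2 = c → a ∈ P) (hz : annProj z ∈ P) :
    z ∈ ReachFrom c N := by
  by_contra hn
  have h1 := isOpenMap_annProj _ (isOpen_reachFrom (c := c) hN)
  have h2 := isOpenMap_annProj _ (isOpen_over_diff_reachFrom (c := c) hN)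
  obtain ⟨a, -, ⟨u, hu, rfl⟩, ⟨v, hv, e⟩⟩ := hP _ _ h1 h2 (fun a ha => by
    obtain ⟨u, rfl⟩ := annProj_surjective a
    by_cases hu : u ∈ ReachFrom c N
    · exact Or.inl ⟨u, hu, rfl⟩
    · exact Or.inr ⟨u, ⟨hPN ha, hu⟩, rfl⟩)
    ⟨annProj (0, c), hc _ rfl, (0, c), reachFrom_self (hPN (hc _ rfl)) rfl, rfl⟩
    ⟨annProj z, hz, z, ⟨hPN hz, hn⟩, rfl⟩
  exact hv.2 (ReachFrom.of_proj_eq hu e.symm)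

end reach

namespace TwistSys

variable (S : TwistSys)

/-- `θ` is the angle of the pair `z, w` obtained by following a path that brings `z` down from
the top boundary line off the set over `P`. -/
def Ang (P : Set Ann) (z w : StripA) (θ : ℝ) : Prop :=
  ∃ t : StripA, t.2 = 1 ∧ ∃ (γ : Path t z) (L : C(I, ℝ)), (∀ s, annProj (γ s) ∈ Pᶜ) ∧
    (∀ s, IsAng (S.disp (γ s) w) (L s)) ∧ L 0 ∈ Ioo 0 (3 * Real.pi / 2) ∧ L 1 = θ

variable {S} {P : Set Ann} {z w : StripA} {θ : ℝ}

lemma ne_of_proj (hz : annProj z ∈ Pᶜ) (hw : annProj w ∈ P) : z ≠ w := by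
  rintro rfl; exact hz hw

lemma Ang.reach (h : S.Ang P z w θ) : z ∈ ReachFrom 1 Pᶜ := by
  obtain ⟨t, ht, γ, L, hγ, -⟩ := h
  exact ⟨t, ht, γ, hγ⟩

lemma Ang.isAng (h : S.Ang P z w θ) : IsAng (S.disp z w) θ := by
  obtain ⟨t, ht, γ, L, hγ, hL, -, rfl⟩ := h
  simpa using hL 1

lemma Ang.mono {P' : Set Ann} (hP : P ⊆ P') (h : S.Ang P' z w θ) : S.Ang P z w θ := by
  obtain ⟨t, ht, γ, L, hγ, hL, h⟩ := h
  exact ⟨t, ht, γ, L, fun s hs => hγ s (hP hs), hL, h⟩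

variable (S) in
lemma F_deckZ (k : ℤ) (u : StripA) : S.F (deckZ k u) = deckZ k (S.F u) := by
  have h1 : ∀ u : StripA, S.F (deckZ 1 u) = deckZ 1 (S.F u) := fun u => by
    have := S.deck u
    simpa [deckZ, deckT] using this
  have hnat : ∀ (n : ℕ) (u : StripA), S.F (deckZ n u) = deckZ n (S.F u) := by
    intro n
    induction n with
    | zero => intro u; simp [deckZ]
    | succ n ih =>
      intro u
      have e : ∀ v : StripA, deckZ ((n + 1 : ℕ) : ℤ) v = deckZ 1 (deckZ n v) := fun v => by
        simp [deckZ, add_assoc]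
      rw [e, h1, ih, ← e]
  obtain ⟨n, rfl | rfl⟩ := k.eq_nat_or_neg
  · exact hnat n u
  · have e : ∀ v : StripA, deckZ n (deckZ (-(n:ℤ)) v) = v := fun v => by simp [deckZ]
    have e' : ∀ v : StripA, deckZ (-(n:ℤ)) (deckZ n v) = v := fun v => by simp [deckZ]
    have := hnat n (deckZ (-(n:ℤ)) u)
    rw [e] at this
    rw [this, e']

variable (S) in
lemma disp_deckZ (k : ℤ) (z w : StripA) : S.disp (deckZ k z) (deckZ k w) = S.disp z w := by
  unfold disp
  rw [F_deckZ, F_deckZ]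
  simp [deckZ]

lemma Ang.shift (k : ℤ) (h : S.Ang P z w θ) : S.Ang P (deckZ k z) (deckZ k w) θ := by
  obtain ⟨t, ht, γ, L, hγ, hL, h⟩ := h
  refine ⟨deckZ k t, ht, γ.map (continuous_deckZ k), L, fun s => ?_, fun s => ?_, h⟩
  · simpa [annProj_deckZ] using hγ s
  · simpa [disp_deckZ] using hL s

variable (S) in
lemma exists_lift_disp {t z b w : StripA} (γ : Path t z) (δ : Path b w)
    (hne : ∀ s, γ s ≠ δ s) (h0 : t.2 = 1 ∨ b.2 = 0) :
    ∃ L : C(I, ℝ), (∀ s, IsAng (S.disp (γ s) (δ s)) (L s)) ∧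
      L 0 ∈ Ioo 0 (3 * Real.pi / 2) := by
  obtain ⟨L, hL, hL0⟩ := exists_lift_path
    ⟨fun s => S.disp (γ s) (δ s), S.continuous_disp.comp (γ.continuous.prodMk δ.continuous)⟩
    (fun s => S.disp_ne_zero (hne s)) (startAng (S.disp (γ 0) (δ 0))) (isAng_startAng _)
  refine ⟨L, hL, ?_⟩
  rw [hL0]
  exact startAng_mem (S.disp_start (hne 0) (by simpa using h0))

lemma exists_ang (hz : z ∈ ReachFrom 1 Pᶜ) (hw : annProj w ∈ P) : ∃ θ, S.Ang P z w θ := by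
  obtain ⟨t, ht, γ, hγ⟩ := hz
  obtain ⟨L, hL, hL0⟩ := S.exists_lift_disp γ (Path.refl w)
    (fun s => ne_of_proj (hγ s) (by simpa using hw)) (Or.inl ht)
  exact ⟨L 1, t, ht, γ, L, hγ, hL, hL0, rfl⟩

lemma start_unique {e : ℂ} {θ θ' : ℝ} (he : e ≠ 0) (h : IsAng e θ) (h' : IsAng e θ')
    (hθ : θ ∈ Ioo 0 (3 * Real.pi / 2)) (hθ' : θ' ∈ Ioo 0 (3 * Real.pi / 2)) : θ = θ' :=
  have hπ := Real.pi_pos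
  h.eq_of_lt h' he (by linarith [hθ.1, hθ'.2]) (by linarith [hθ.2, hθ'.1])

/-- Bringing `z` down from the top and bringing `w` up from the bottom, along disjoint paths,
produce the same angle. -/
lemma angle_square {t z b w : StripA} (γ : Path t z) (δ : Path b w) (ht : t.2 = 1)
    (hb : b.2 = 0) (hne : ∀ s s', γ s ≠ δ s') {L M : I → ℝ} (hLc : Continuous L)
    (hMc : Continuous M) (hL : ∀ s, IsAng (S.disp (γ s) w) (L s))
    (hM : ∀ s, IsAng (S.disp z (δ s)) (M s)) (hL0 : L 0 ∈ Ioo 0 (3 * Real.pi / 2))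
    (hM0 : M 0 ∈ Ioo 0 (3 * Real.pi / 2)) : L 1 = M 1 := by
  have hst : ∀ s', 0 < (S.disp t (δ s')).im ∨ (S.disp t (δ s')).re < 0 := fun s' =>
    S.disp_start (by simpa using hne 0 s') (Or.inl ht)
  have hst' : ∀ s, 0 < (S.disp (γ s) b).im ∨ (S.disp (γ s) b).re < 0 := fun s =>
    S.disp_start (by simpa using hne s 0) (Or.inr hb)
  obtain ⟨Λ, hΛ, hΛ0⟩ := exists_lift_homotopy (A := I)
    ⟨fun x => S.disp (γ x.1) (δ x.2), S.continuous_disp.comp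
      ((γ.continuous.comp continuous_fst).prodMk (δ.continuous.comp continuous_snd))⟩
    (fun x => S.disp_ne_zero (hne _ _))
    ⟨fun s' => startAng (S.disp t (δ s')), continuous_iff_continuousAt.2 fun s' =>
      ContinuousAt.comp' (continuousAt_startAng (hst s'))
        (S.continuous_disp.comp (continuous_const.prodMk δ.continuous)).continuousAt⟩
    (fun s' => by simpa using isAng_startAng _)
  simp only [ContinuousMap.coe_mk] at hΛ hΛ0
  have e1 : L 1 = Λ (1, 1) := by
    refine lift_unique (h := fun s => S.disp (γ s) w) (M := fun s => Λ (s, 1))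
      (fun s => S.disp_ne_zero (by simpa using hne s 1)) hLc (by fun_prop) hL
      (fun s => by simpa using hΛ (s, 1)) ?_ 1
    refine start_unique (S.disp_ne_zero (z := t) (w := w) (by simpa using hne 0 1))
      (by simpa using hL 0) (by simpa using hΛ (0, 1)) hL0 ?_
    rw [hΛ0]; exact startAng_mem (hst 1)
  have e2 : Λ (1, 0) = startAng (S.disp z b) := by
    have := lift_unique (h := fun s => S.disp (γ s) b) (L := fun s => Λ (s, 0))
      (M := fun s => startAng (S.disp (γ s) b))
      (fun s => S.disp_ne_zero (by simpa using hne s 0)) (by fun_prop)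
      (continuous_iff_continuousAt.2 fun s =>
        ContinuousAt.comp' (continuousAt_startAng (hst' s))
        (S.continuous_disp.comp (γ.continuous.prodMk continuous_const)).continuousAt)
      (fun s => by simpa using hΛ (s, 0)) (fun s => isAng_startAng _)
      (by simpa using hΛ0 0) 1
    simpa using this
  rw [e1]
  refine (lift_unique (h := fun s => S.disp z (δ s)) (L := M) (M := fun s => Λ (1, s))
      (fun s => S.disp_ne_zero (by simpa using hne 1 s)) hMc (by fun_prop) hM
      (fun s => by simpa using hΛ (1, s)) ?_ 1).symm
  refine start_unique (S.disp_ne_zero (z := z) (w := b) (by simpa using hne 1 0))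
      (by simpa using hM 0) (by simpa using hΛ (1, 0)) hM0 ?_
  rw [e2]; simpa using startAng_mem (hst' 1)

/-- A path from the bottom to a point over `P` that avoids two given paths off `P`. -/
lemma exists_path_avoiding (hPp : IsPreconnected P) (hP0 : C0 ⊆ P)
    (hw : annProj w ∈ P) {K : Set Ann} (hK : IsClosed K) (hKP : ∀ a ∈ P, a ∉ K) :
    ∃ b : StripA, b.2 = 0 ∧ ∃ δ : Path b w, ∀ s, annProj (δ s) ∉ K :=
  mem_reachFrom_of_isPreconnected hPp hK.isOpen_compl hKP (fun _ ha => hP0 (mem_C0.2 ha)) hw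

lemma Ang.unique (hPp : IsPreconnected P) (hP0 : C0 ⊆ P)
    (hw : annProj w ∈ P) {θ θ' : ℝ} (h : S.Ang P z w θ) (h' : S.Ang P z w θ') : θ = θ' := by
  obtain ⟨t, ht, γ, L, hγ, hL, hL0, rfl⟩ := h
  obtain ⟨t', ht', γ', L', hγ', hL', hL0', rfl⟩ := h'
  have hKc : ∀ {t z : StripA} (γ : Path t z), IsClosed (range fun s => annProj (γ s)) :=
    fun γ => (isCompact_range (continuous_annProj.comp γ.continuous)).isClosed
  obtain ⟨b, hb, δ, hδ⟩ := exists_path_avoiding hPp hP0 hw ((hKc γ).union (hKc γ')) (by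
    rintro a ha (⟨s, rfl⟩ | ⟨s, rfl⟩)
    · exact hγ s ha
    · exact hγ' s ha)
  have n1 : ∀ s s', γ s ≠ δ s' := fun s s' e => hδ s' (Or.inl ⟨s, by rw [← e]⟩)
  have n2 : ∀ s s', γ' s ≠ δ s' := fun s s' e => hδ s' (Or.inr ⟨s, by rw [← e]⟩)
  obtain ⟨M, hM, hM0⟩ := S.exists_lift_disp (Path.refl z) δ
    (fun s => by simpa using n1 1 s) (Or.inr hb)
  rw [angle_square γ δ ht hb n1 L.continuous M.continuous hL hM hL0 hM0,
    angle_square γ' δ ht' hb n2 L'.continuous M.continuous hL' hM hL0' hM0]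

/-- The angle can be continued along paths off `P`. -/
lemma Ang.extend {z' : StripA} (h : S.Ang P z w θ) (γ' : Path z z') (L' : C(I, ℝ))
    (hγ' : ∀ s, annProj (γ' s) ∈ Pᶜ) (hL' : ∀ s, IsAng (S.disp (γ' s) w) (L' s))
    (h0 : L' 0 = θ) : S.Ang P z' w (L' 1) := by
  obtain ⟨t, ht, γ, L, hγ, hL, hL0, hL1⟩ := h
  let A : Path (L 0) θ := ⟨L, rfl, hL1⟩
  let B : Path θ (L' 1) := ⟨L', h0, rfl⟩
  refine ⟨t, ht, γ.trans γ', (A.trans B).toContinuousMap,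
    path_trans_forall (p := fun z => annProj z ∈ Pᶜ) γ γ' hγ hγ', fun s => ?_, ?_, ?_⟩
  · show IsAng (S.disp (γ.trans γ' s) w) (A.trans B s)
    rw [Path.trans_apply, Path.trans_apply]
    split_ifs
    · exact hL _
    · exact hL' _
  · show (A.trans B) 0 ∈ _
    simpa using hL0
  · show (A.trans B) 1 = _
    simp

/-- The angle depends continuously on both points. -/
lemma Ang.nhds (hPc : IsClosed P) (hw : annProj w ∈ P) (h : S.Ang P z w θ) {Θ : Set ℝ}
    (hΘ : Θ ∈ 𝓝 θ) : ∃ U ∈ 𝓝 z, ∃ V ∈ 𝓝 w, ∀ z' ∈ U, ∀ w' ∈ V, annProj w' ∈ P →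
      ∃ θ' ∈ Θ, S.Ang P z' w' θ' := by
  obtain ⟨t, ht, γ, L, hγ, hL, hL0, hL1⟩ := id h
  have hst : ∀ w' : {w' // annProj w' ∈ P}, 0 < (S.disp t w').im ∨ (S.disp t w').re < 0 :=
    fun w' => S.disp_start (ne_of_proj (by simpa using hγ 0) w'.2) (Or.inl ht)
  obtain ⟨Λ, hΛ, hΛ0⟩ := exists_lift_homotopy (A := {w' // annProj w' ∈ P})
    ⟨fun x => S.disp (γ x.1) x.2, S.continuous_disp.comp
      ((γ.continuous.comp continuous_fst).prodMk (continuous_subtype_val.comp continuous_snd))⟩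
    (fun x => S.disp_ne_zero (ne_of_proj (hγ _) x.2.2))
    ⟨fun w' => startAng (S.disp t w'), continuous_iff_continuousAt.2 fun w' =>
      ContinuousAt.comp' (continuousAt_startAng (hst w'))
        (S.continuous_disp.comp (continuous_const.prodMk continuous_subtype_val)).continuousAt⟩
    (fun w' => by simpa using isAng_startAng _)
  simp only [ContinuousMap.coe_mk] at hΛ hΛ0
  have hzP : annProj z ∈ Pᶜ := by simpa using hγ 1
  have hbase : ∀ w' : {w' // annProj w' ∈ P}, S.Ang P z w' (Λ (1, w')) := fun w' =>
    ⟨t, ht, γ, Λ.comp ⟨fun s => (s, w'), by fun_prop⟩, hγ, fun s => hΛ (s, w'), by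
      simpa [hΛ0] using startAng_mem (hst w'), rfl⟩
  have hθ : Λ (1, ⟨w, hw⟩) = θ := by
    rw [← hL1]
    refine lift_unique (h := fun s => S.disp (γ s) w) (L := fun s => Λ (s, ⟨w, hw⟩))
      (fun s => S.disp_ne_zero (ne_of_proj (hγ s) hw)) (by fun_prop) L.continuous
      (fun s => hΛ (s, ⟨w, hw⟩)) hL ?_ 1
    refine start_unique (S.disp_ne_zero (ne_of_proj (hγ 0) hw)) (hΛ (0, ⟨w, hw⟩)) (hL 0) ?_ hL0
    rw [hΛ0]; exact startAng_mem (hst _)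
  let R : StripA × {w' // annProj w' ∈ P} → ℂ := fun x => S.disp x.1 x.2 / S.disp z x.2
  have hRc : Continuous R := by
    refine Continuous.div ?_ ?_ fun x => S.disp_ne_zero (ne_of_proj hzP x.2.2)
    · exact S.continuous_disp.comp
        (continuous_fst.prodMk (continuous_subtype_val.comp continuous_snd))
    · exact S.continuous_disp.comp
        (continuous_const.prodMk (continuous_subtype_val.comp continuous_snd))
  have hR1 : ∀ w', R (z, w') = 1 := fun w' =>
    div_self (S.disp_ne_zero (ne_of_proj hzP w'.2))
  have ev1 : ∀ᶠ x in 𝓝 (z, (⟨w, hw⟩ : {w' // annProj w' ∈ P})), R x ∈ Complex.slitPlane :=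
    hRc.continuousAt.eventually_mem (Complex.isOpen_slitPlane.mem_nhds (by
      rw [hR1]; exact Complex.one_mem_slitPlane))
  have ev2 : ∀ᶠ x in 𝓝 (z, (⟨w, hw⟩ : {w' // annProj w' ∈ P})),
      Λ (1, x.2) + (R x).arg ∈ Θ := by
    have hc : ContinuousAt (fun x : StripA × {w' // annProj w' ∈ P} =>
        Λ (1, x.2) + (R x).arg) (z, ⟨w, hw⟩) := by
      refine ContinuousAt.add (by fun_prop) ?_
      refine ContinuousAt.comp' (Complex.continuousAt_arg ?_) hRc.continuousAt
      rw [hR1]; exact Complex.one_mem_slitPlane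
    refine hc.eventually_mem ?_
    simpa [hR1, hθ] using hΘ
  have ev3 : ∀ᶠ z' in 𝓝 z, annProj z' ∈ Pᶜ :=
    continuous_annProj.continuousAt.eventually_mem (hPc.isOpen_compl.mem_nhds hzP)
  have ev := (ev1.and ev2).and (continuous_fst.continuousAt.eventually ev3)
  rw [nhds_prod_eq, eventually_prod_iff] at ev
  obtain ⟨pa, hpa, pb, hpb, hab⟩ := ev
  obtain ⟨r, hr, hball⟩ := Metric.eventually_nhds_iff_ball.1 hpa
  obtain ⟨V, hV, hVs⟩ := (mem_nhds_subtype _ _ _).1 hpb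
  refine ⟨Metric.ball z r, Metric.ball_mem_nhds _ hr, V, hV, fun z' hz' w' hw' hwP => ?_⟩
  have hpbw : pb ⟨w', hwP⟩ := hVs (show (⟨w', hwP⟩ : {w' // annProj w' ∈ P}) ∈ _ from hw')
  have hall : ∀ s, _ := fun s =>
    hab (hball _ (segPath_mem_ball hz' s)) hpbw
  have hcont : Continuous fun s : I =>
      Λ (1, ⟨w', hwP⟩) + (R (segPath z z' s, ⟨w', hwP⟩)).arg := by
    refine continuous_const.add (continuous_iff_continuousAt.2 fun s => ?_)
    exact ContinuousAt.comp' (Complex.continuousAt_arg (hall s).1.1)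
      (hRc.comp ((segPath z z').continuous.prodMk continuous_const)).continuousAt
  refine ⟨Λ (1, ⟨w', hwP⟩) + (R (z', ⟨w', hwP⟩)).arg, ?_, ?_⟩
  · simpa using (hall 1).1.2
  · have := (hbase ⟨w', hwP⟩).extend (segPath z z') ⟨_, hcont⟩ (fun s => (hall s).2)
      (fun s => (hbase ⟨w', hwP⟩).isAng.add_arg (S.disp_ne_zero (ne_of_proj hzP hwP)))
      (by simp [hR1])
    simpa using this

variable (S) in
lemma proj_image (P : Set Ann) (u : StripA) : annProj (S.F u) ∈ S.f '' P ↔ annProj u ∈ P := by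
  rw [S.proj, S.f.injective.mem_set_image]

lemma step_mem {t z w : StripA} (γ : Path t z) (hne : ∀ s, γ s ≠ w)
    {L L' : C(I, ℝ)} (hL : ∀ s, IsAng (S.disp (γ s) w) (L s))
    (hL' : ∀ s, IsAng (S.disp (S.F (γ s)) (S.F w)) (L' s)) (h0 : L 0 ∈ Ioo 0 (3 * Real.pi / 2))
    (h0' : L' 0 ∈ Ioo 0 (3 * Real.pi / 2)) :
    L' 1 - L 1 + Real.pi / 2 ∈ Ioo (-Real.pi) Real.pi := by
  have hne' : ∀ s, S.F (γ s) ≠ S.F w := fun s => S.F.injective.ne (hne s)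
  have hav : ∀ s, L' s - L s + Real.pi / 2 ≠ -Real.pi ∧ L' s - L s + Real.pi / 2 ≠ Real.pi :=
    fun s => ang_step_ne (hL s) (hL' s) (S.disp_ne_zero (hne s)) (S.disp_ne_zero (hne' s))
      (S.disp_step _ _)
  refine mem_Ioo_of_avoid (s := univ) (g := fun s => L' s - L s + Real.pi / 2) (x0 := 0)
    isPreconnected_univ (by fun_prop) (mem_univ _) ?_ (fun s _ => hav s) (mem_univ 1)
  exact ang_step_start (hL 0) (hL' 0) (S.disp_ne_zero (hne 0)) (S.disp_ne_zero (hne' 0)) h0 h0'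
    (hav 0).2

lemma Ang.step (hw : annProj w ∈ P) (h : S.Ang P z w θ) :
    ∃ θ', S.Ang (S.f '' P) (S.F z) (S.F w) θ' ∧
      θ' - θ + Real.pi / 2 ∈ Ioo (-Real.pi) Real.pi := by
  obtain ⟨t, ht, γ, L, hγ, hL, hL0, rfl⟩ := h
  have hne : ∀ s, γ s ≠ w := fun s => ne_of_proj (hγ s) hw
  obtain ⟨L', hL', hL0'⟩ := S.exists_lift_disp (γ.map S.F.continuous) (Path.refl (S.F w))
    (fun s => by simpa using hne s) (Or.inl ((S.top t).2 ht))
  refine ⟨L' 1, ⟨S.F t, (S.top t).2 ht, γ.map S.F.continuous, L', fun s => ?_, hL', hL0', rfl⟩,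
    step_mem γ hne hL hL' hL0 hL0'⟩
  show annProj (S.F (γ s)) ∉ _
  rw [S.proj_image]; exact hγ s

lemma Ang.step_symm (hw : annProj w ∈ S.f '' P) {θ' : ℝ} (h : S.Ang (S.f '' P) z w θ') :
    ∃ θ, S.Ang P (S.F.symm z) (S.F.symm w) θ ∧
      θ' - θ + Real.pi / 2 ∈ Ioo (-Real.pi) Real.pi := by
  obtain ⟨t, ht, γ, L', hγ, hL', hL0', rfl⟩ := h
  have hne : ∀ s, γ s ≠ w := fun s => ne_of_proj (hγ s) hw
  have ht' := (S.top_symm t).2 ht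
  obtain ⟨L, hL, hL0⟩ := S.exists_lift_disp (γ.map S.F.symm.continuous)
    (Path.refl (S.F.symm w)) (fun s => by simpa using hne s) (Or.inl ht')
  refine ⟨L 1, ⟨S.F.symm t, ht', γ.map S.F.symm.continuous, L, fun s => ?_, hL, hL0, rfl⟩, ?_⟩
  · show annProj (S.F.symm (γ s)) ∉ P
    rw [← S.proj_image, S.F.apply_symm_apply]; exact hγ s
  · exact step_mem (γ.map S.F.symm.continuous) (fun s => by simpa using hne s) hL
      (by simpa using hL') hL0 hL0'

end TwistSys

lemma isAng_down {e : ℂ} (hr : e.re = 0) (hi : e.im < 0) : IsAng e (-(Real.pi / 2)) := by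
  have hn : ‖e‖ = -e.im := by
    rw [← abs_of_neg hi]
    have := Complex.abs_im_eq_norm.2 hr
    exact this.symm
  refine ⟨by simp [hr], ?_⟩
  rw [Real.sin_neg, Real.sin_pi_div_two, hn]; ring

lemma IsAng.le_of_down {e : ℂ} {θ : ℝ} (h : IsAng e θ) (hr : e.re = 0) (hi : e.im < 0)
    (hθ : θ < 3 * Real.pi / 2) : θ ≤ -(Real.pi / 2) := by
  by_contra! hc
  have hπ := Real.pi_pos
  have he : e ≠ 0 := fun h0 => by simp [h0] at hi
  have := h.eq_of_lt (isAng_down hr hi) he (by linarith) (by linarith)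
  linarith

namespace TwistSys

variable {S : TwistSys} {P : Set Ann} {z w : StripA} {θ : ℝ}

lemma exists_ang_lt_of_far (hPc : IsClosed P) {z₀ : StripA} (hz : z₀ ∈ ReachFrom 1 Pᶜ) :
    ∃ U ∈ 𝓝 z₀, ∃ R : ℝ, ∀ z ∈ U, ∀ w, annProj w ∈ P → R < |w.1| →
      ∃ θ < 3 * Real.pi / 2, S.Ang P z w θ := by
  have hπ := Real.pi_pos
  obtain ⟨r, hr, hb⟩ := exists_ball_over hPc.isOpen_compl (ReachFrom.proj_mem hz)
  obtain ⟨t, ht, γ₀, hγ₀⟩ := hz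
  obtain ⟨M, hM⟩ := (isCompact_range γ₀.continuous).isBounded.subset_closedBall z₀
  refine ⟨Metric.ball z₀ r, Metric.ball_mem_nhds _ hr, |z₀.1| + max M r, fun z hzb w hw hR => ?_⟩
  obtain ⟨γ, hγ, hγb⟩ : ∃ γ : Path t z, (∀ s, annProj (γ s) ∈ Pᶜ) ∧
      ∀ s, dist (γ s) z₀ ≤ max M r := by
    refine ⟨γ₀.trans (segPath z₀ z), path_trans_forall (p := fun z => annProj z ∈ Pᶜ) _ _ hγ₀
      (fun s => hb _ (segPath_mem_ball hzb s)),
      path_trans_forall (p := fun z => dist z z₀ ≤ max M r) _ _ (fun s => ?_) fun s => ?_⟩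
    · exact (hM (mem_range_self s)).trans (le_max_left _ _)
    · exact (segPath_mem_ball hzb s).le.trans (le_max_right _ _)
  have hne : ∀ s, γ s ≠ w := fun s => ne_of_proj (hγ s) hw
  obtain ⟨L, hL, hL0⟩ := S.exists_lift_disp γ (Path.refl w) (by simpa using hne) (Or.inl ht)
  simp only [Path.refl_apply] at hL
  refine ⟨L 1, ?_, t, ht, γ, L, hγ, hL, hL0, rfl⟩
  have hx : ∀ s, |(γ s).1| < |w.1| := fun s => by
    have h1 : |(γ s).1 - z₀.1| ≤ dist (γ s) z₀ := le_max_left _ _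
    have := abs_sub_abs_le_abs_sub (γ s).1 z₀.1
    linarith [hγb s]
  rcases lt_or_ge w.1 0 with hw0 | hw0
  · rw [abs_of_neg hw0] at hx
    have hre : ∀ s, 0 < (S.disp (γ s) w).re := fun s => by
      simp only [disp]; linarith [(abs_lt.1 (hx s)).1]
    have hcos := fun s => ((hL s).cos_pos_iff (S.disp_ne_zero (hne s))).2 (hre s)
    have h0 : L 0 < Real.pi / 2 := by
      by_contra! hc
      exact (hcos 0).not_ge (Real.cos_nonpos_of_pi_div_two_le_of_le hc (by linarith [hL0.2]))
    have := mem_Ioo_of_avoid (s := univ) (g := fun s => L s) (a := -(Real.pi / 2))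
      (b := Real.pi / 2) (x0 := 0) isPreconnected_univ (by fun_prop) (mem_univ _)
      ⟨by linarith [hL0.1], h0⟩ (fun s _ => by
        constructor <;> intro hc <;> have := hcos s <;> rw [hc] at this <;> simp at this)
      (mem_univ 1)
    linarith [this.2]
  · rw [abs_of_nonneg hw0] at hx
    have hre : ∀ s, (S.disp (γ s) w).re < 0 := fun s => by
      simp only [disp]; linarith [(abs_lt.1 (hx s)).2]
    have hcos := fun s => ((hL s).cos_neg_iff (S.disp_ne_zero (hne s))).2 (hre s)
    have h0 : Real.pi / 2 < L 0 := by
      by_contra! hc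
      exact (hcos 0).not_ge (Real.cos_nonneg_of_mem_Icc ⟨by linarith [hL0.1], hc⟩)
    have := mem_Ioo_of_avoid (s := univ) (g := fun s => L s) (a := Real.pi / 2)
      (b := 3 * Real.pi / 2) (x0 := 0) isPreconnected_univ (by fun_prop) (mem_univ _)
      ⟨h0, hL0.2⟩ (fun s _ => by
        constructor <;> intro hc <;> have := hcos s <;> rw [hc] at this
        · simp at this
        · rw [show 3 * Real.pi / 2 = Real.pi / 2 + Real.pi by ring, Real.cos_add_pi] at this
          simp at this)
      (mem_univ 1)
    exact this.2

lemma disp_of_down (x : ℝ) {a b : UI} (h : a < b) :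
    (S.disp (x, a) (x, b)).re = 0 ∧ (S.disp (x, a) (x, b)).im < 0 :=
  ⟨by simp [disp], by simp only [disp]; linarith [S.twist x a b h]⟩

lemma down_of_disp (hr : (S.disp z w).re = 0) (hi : (S.disp z w).im < 0) :
    z.1 = w.1 ∧ z.2 < w.2 := by
  obtain ⟨x, a⟩ := z
  obtain ⟨x', b⟩ := w
  simp only [disp] at hr hi
  obtain rfl : x = x' := by linarith
  refine ⟨rfl, ?_⟩
  by_contra! hc
  linarith [S.twist_le x hc]

lemma exists_ang_of_vertical (hz : ∀ y, z.2 ≤ y → annProj (z.1, y) ∈ Pᶜ)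
    (hw : annProj w ∈ P) : ∃ θ ∈ Ioo (-(Real.pi / 2)) (3 * Real.pi / 2), S.Ang P z w θ := by
  have hπ := Real.pi_pos
  have hfst : ∀ s, (segPath (z.1, 1) z s).1 = z.1 := fun s => by
    rw [segPath_apply_fst]; ring
  have hsnd : ∀ s, z.2 ≤ (segPath (z.1, 1) z s).2 := fun s => by
    rw [← Subtype.coe_le_coe, segPath_apply_snd]
    have h0 := s.2.1; have h1 := s.2.2; have := z.2.2.2
    simp only [Icc.coe_one]
    nlinarith
  have hγ : ∀ s, annProj (segPath (z.1, 1) z s) ∈ Pᶜ := fun s => by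
    have := hz _ (hsnd s)
    rwa [← hfst s] at this
  have hne : ∀ s, segPath (z.1, 1) z s ≠ w := fun s => ne_of_proj (hγ s) hw
  obtain ⟨L, hL, hL0⟩ := S.exists_lift_disp (segPath (z.1, 1) z) (Path.refl w)
    (by simpa using hne) (Or.inl rfl)
  simp only [Path.refl_apply] at hL
  refine ⟨L 1, ?_, _, rfl, segPath (z.1, 1) z, L, hγ, hL, hL0, rfl⟩
  refine mem_Ioo_of_avoid (s := univ) (g := fun s => L s) (x0 := 0) isPreconnected_univ
    (by fun_prop) (mem_univ _) ⟨by linarith [hL0.1], hL0.2⟩ (fun s _ => ?_) (mem_univ 1)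
  have key : ¬ (Real.cos (L s) = 0 ∧ Real.sin (L s) = -1) := by
    rintro ⟨h1, h2⟩
    have hn := norm_pos_iff.2 (S.disp_ne_zero (hne s))
    obtain ⟨e1, e2⟩ := down_of_disp (S := S) (z := segPath (z.1, 1) z s) (w := w)
      (by rw [(hL s).1, h1, mul_zero]) (by rw [(hL s).2, h2]; linarith)
    refine hz w.2 ((hsnd s).trans e2.le) ?_
    rw [← hfst s, e1]; exact hw
  constructor <;> intro hc <;> apply key <;> rw [hc]
  · simp
  · rw [show 3 * Real.pi / 2 = Real.pi / 2 + Real.pi by ring, Real.cos_add_pi, Real.sin_add_pi]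
    simp

instance : (volume : Measure UI).IsOpenPosMeasure := by
  refine ⟨fun U hU hne => ?_⟩
  obtain ⟨V, hV, rfl⟩ := isOpen_induced_iff.1 hU
  obtain ⟨x, hx⟩ := hne
  have hx2 : (x : ℝ) ∈ closure (Ioo (0:ℝ) 1) := by rw [closure_Ioo zero_ne_one]; exact x.2
  obtain ⟨y, hy, hy'⟩ := mem_closure_iff.1 hx2 V hV hx
  have h1 : 0 < volume (V ∩ Ioo (0:ℝ) 1) := (hV.inter isOpen_Ioo).measure_pos _ ⟨y, hy, hy'⟩
  rw [Measure.Subtype.volume_def, Measure.comap_apply _ Subtype.val_injective _ _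
    (hV.preimage continuous_subtype_val).measurableSet]
  · refine (h1.trans_le (measure_mono ?_)).ne'
    rintro u ⟨hu, hu'⟩
    exact ⟨⟨u, hu'.1.le, hu'.2.le⟩, hu, rfl⟩
  · intro s hs
    exact (MeasurableEmbedding.subtype_coe measurableSet_Icc).measurableSet_image.2 hs

end TwistSys

/-- The part of the complement of `P` that can be reached from the top circle. -/
def Upper (P : Set Ann) : Set Ann := annProj '' ReachFrom 1 Pᶜ

lemma isOpen_upper {P : Set Ann} (hP : IsClosed P) : IsOpen (Upper P) :=
  isOpenMap_annProj _ (isOpen_reachFrom hP.isOpen_compl)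

lemma annProj_mem_upper {P : Set Ann} {z : StripA} :
    annProj z ∈ Upper P ↔ z ∈ ReachFrom 1 Pᶜ := by
  refine ⟨?_, fun h => ⟨z, h, rfl⟩⟩
  rintro ⟨u, hu, e⟩
  exact ReachFrom.of_proj_eq hu e

lemma upper_subset {P : Set Ann} : Upper P ⊆ Pᶜ := by
  rintro _ ⟨u, hu, rfl⟩
  exact ReachFrom.proj_mem hu

lemma upper_anti {P P' : Set Ann} (h : P ⊆ P') : Upper P' ⊆ Upper P :=
  image_mono (ReachFrom.mono (compl_subset_compl.2 h))

lemma eq_empty_of_null {α : Type*} [TopologicalSpace α] [MeasurableSpace α] (μ : Measure α)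
    [μ.IsOpenPosMeasure] {V : Set α} (hV : IsOpen V) (h : μ V = 0) : V = ∅ :=
  (hV.measure_eq_zero_iff μ).1 h

namespace TwistSys

variable (S : TwistSys) {P : Set Ann} {z w : StripA} {θ : ℝ}

lemma mem_reach_image (z : StripA) :
    S.F z ∈ ReachFrom 1 (S.f '' P)ᶜ ↔ z ∈ ReachFrom 1 Pᶜ := by
  constructor
  · rintro ⟨t, ht, γ, hγ⟩
    refine ⟨S.F.symm t, (S.top_symm t).2 ht,
      (γ.map S.F.symm.continuous).cast rfl (by simp), fun s => ?_⟩
    show annProj (S.F.symm (γ s)) ∉ P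
    rw [← S.proj_image, S.F.apply_symm_apply]; exact hγ s
  · rintro ⟨t, ht, γ, hγ⟩
    refine ⟨S.F t, (S.top t).2 ht, γ.map S.F.continuous, fun s => ?_⟩
    show annProj (S.F (γ s)) ∉ _
    rw [S.proj_image]; exact hγ s

lemma upper_image (P : Set Ann) : Upper (S.f '' P) = S.f '' Upper P := by
  ext a
  obtain ⟨z, rfl⟩ := annProj_surjective a
  obtain ⟨u, rfl⟩ := S.F.surjective z
  rw [annProj_mem_upper, mem_reach_image, S.proj, S.f.injective.mem_set_image,
    annProj_mem_upper]

lemma measure_image (s : Set Ann) : volume (S.f '' s) = volume s := by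
  rw [← S.area.measure_preimage_emb S.f.measurableEmbedding, S.f.injective.preimage_image]

lemma measure_upper_diff (hPc : IsClosed P) (hPf : P ⊆ S.f '' P) :
    volume (Upper P \ Upper (S.f '' P)) = 0 := by
  have hc : IsClosed (S.f '' P) := S.f.isClosedMap _ hPc
  rw [measure_sdiff (upper_anti hPf) (isOpen_upper hc).measurableSet.nullMeasurableSet
    (measure_ne_top _ _), upper_image, measure_image, tsub_self]

/-- The points that see a point over `P` under an angle in `Θ`. -/
def Sees (Θ : Set ℝ) (P : Set Ann) : Set StripA :=
  {z | ∃ w, annProj w ∈ P ∧ ∃ θ ∈ Θ, S.Ang P z w θ}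

variable {S}

lemma Sees.of_proj_eq {Θ : Set ℝ} {z z' : StripA} (h : z ∈ S.Sees Θ P)
    (e : annProj z = annProj z') : z' ∈ S.Sees Θ P := by
  obtain ⟨k, rfl⟩ := annProj_eq_iff.1 e
  obtain ⟨w, hw, θ, hθ, ha⟩ := h
  exact ⟨deckZ k w, by rwa [annProj_deckZ], θ, hθ, ha.shift k⟩

lemma isOpen_sees (hPc : IsClosed P) {Θ : Set ℝ} (hΘ : IsOpen Θ) : IsOpen (S.Sees Θ P) := by
  rw [isOpen_iff_mem_nhds]
  rintro z ⟨w, hw, θ, hθ, h⟩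
  obtain ⟨U, hU, V, hV, hUV⟩ := h.nhds hPc hw (hΘ.mem_nhds hθ)
  exact mem_of_superset hU fun z' hz' => ⟨w, hw, hUV z' hz' w (mem_of_mem_nhds hV) hw⟩

lemma isOpen_reach_diff_sees (hPc : IsClosed P) (hPp : IsPreconnected P) (hP0 : C0 ⊆ P) :
    IsOpen (ReachFrom 1 Pᶜ \ S.Sees (Ici (3 * Real.pi / 2)) P) := by
  rw [isOpen_iff_mem_nhds]
  rintro z ⟨hz, hzs⟩
  obtain ⟨U₀, hU₀, R, hR⟩ := exists_ang_lt_of_far (S := S) hPc hz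
  have hK : IsCompact (annProj ⁻¹' P ∩ Icc (-R) R ×ˢ univ) :=
    (isCompact_Icc.prod isCompact_univ).inter_left (hPc.preimage continuous_annProj)
  have key : ∀ᶠ z' in 𝓝 z, ∀ w ∈ annProj ⁻¹' P ∩ Icc (-R) R ×ˢ univ,
      ∃ θ < 3 * Real.pi / 2, S.Ang P z' w θ := by
    refine (hK.eventually_forall_of_forall_eventually
      (P := fun z' w => annProj w ∈ P → ∃ θ < 3 * Real.pi / 2, S.Ang P z' w θ) ?_).mono ?_
    · rintro w ⟨hw, -⟩
      obtain ⟨θ, hθ⟩ := exists_ang (S := S) hz hw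
      have hlt : θ < 3 * Real.pi / 2 := by
        by_contra! hc
        exact hzs ⟨w, hw, θ, hc, hθ⟩
      obtain ⟨U, hU, V, hV, hUV⟩ := hθ.nhds hPc hw (Iio_mem_nhds hlt)
      rw [nhds_prod_eq]
      refine mem_of_superset (prod_mem_prod hU hV) ?_
      rintro ⟨z', w'⟩ ⟨h1, h2⟩ h3
      exact hUV z' h1 w' h2 h3
    · exact fun z' h w hw => h w hw hw.1
  filter_upwards [key, hU₀, (isOpen_reachFrom hPc.isOpen_compl).mem_nhds hz] with z' h1 h2 h3
  refine ⟨h3, ?_⟩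
  rintro ⟨w, hw, θ, hθ, ha⟩
  obtain ⟨θ', hθ', ha'⟩ : ∃ θ < 3 * Real.pi / 2, S.Ang P z' w θ := by
    by_cases hwR : R < |w.1|
    · exact hR z' h2 w hw hwR
    · exact h1 w ⟨hw, abs_le.1 (not_lt.1 hwR), mem_univ _⟩
  rw [ha'.unique hPp hP0 hw ha] at hθ'
  exact absurd hθ' (not_lt.2 hθ)

lemma Ang.lt_of_top (hPp : IsPreconnected P) (hP0 : C0 ⊆ P) (hz : z.2 = 1)
    (hw : annProj w ∈ P) (h : S.Ang P z w θ) : θ < 3 * Real.pi / 2 := by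
  have hzP := ReachFrom.proj_mem h.reach
  obtain ⟨L, hL, hL0⟩ := S.exists_lift_disp (Path.refl z) (Path.refl w)
    (fun s => by simpa using ne_of_proj hzP hw) (Or.inl hz)
  have h0 : S.Ang P z w (L 0) := by
    refine ⟨z, hz, Path.refl z, ContinuousMap.const _ (L 0), by simpa using hzP, fun s => ?_,
      hL0, rfl⟩
    simpa using hL 0
  rw [h.unique hPp hP0 hw h0]
  exact hL0.2

/-- Under an expanding continuum, no pair turns by more than `3π/2`. -/
theorem Ang.lt_of_expanding (hPc : IsClosed P) (hPp : IsPreconnected P) (hP0 : C0 ⊆ P)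
    (hPf : P ⊆ S.f '' P) (hw : annProj w ∈ S.f '' P) (h : S.Ang (S.f '' P) z w θ) :
    θ < 3 * Real.pi / 2 := by
  set P' := S.f '' P with hP'
  have hPc' : IsClosed P' := S.f.isClosedMap _ hPc
  have hPp' : IsPreconnected P' := hPp.image _ S.f.continuous.continuousOn
  have hP0' : C0 ⊆ P' := hP0.trans hPf
  set O := S.Sees (Ioi (3 * Real.pi / 2)) P with hO
  set C := S.Sees (Ici (3 * Real.pi / 2)) P' with hC
  have hOo : IsOpen O := isOpen_sees hPc isOpen_Ioi
  have hCO : S.F ⁻¹' C ⊆ O := by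
    rintro z ⟨w, hw, θ, hθ, ha⟩
    have hne := ne_of_proj (ReachFrom.proj_mem ha.reach) hw
    obtain ⟨θ₀, ha₀, hs⟩ := ha.step_symm hw
    rw [S.F.symm_apply_apply] at ha₀
    refine ⟨S.F.symm w, by rwa [← S.proj_image, S.F.apply_symm_apply], θ₀, ?_, ha₀⟩
    have e : S.disp (S.F z) w = ⟨(S.F z).1 - w.1, (S.F (S.F z)).1 - (S.F w).1⟩ := rfl
    have e0 : S.disp z (S.F.symm w) = ⟨z.1 - (S.F.symm w).1, (S.F z).1 - w.1⟩ := by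
      simp [disp]
    have hne0 := ne_of_proj (ReachFrom.proj_mem ha₀.reach)
      (by rwa [← S.proj_image, S.F.apply_symm_apply] : annProj (S.F.symm w) ∈ P)
    exact ang_step_high (e0 ▸ ha₀.isAng) (e ▸ ha.isAng) (e0 ▸ S.disp_ne_zero hne0)
      (e ▸ S.disp_ne_zero hne) hs hθ
  have hOC : O ∩ ReachFrom 1 P'ᶜ ⊆ C := by
    rintro z ⟨⟨w, hw, θ, hθ, ha⟩, hz⟩
    obtain ⟨θ', ha'⟩ := exists_ang (S := S) hz (hPf hw)
    refine ⟨w, hPf hw, θ', ?_, ha'⟩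
    rw [(ha'.mono hPf).unique hPp hP0 hw ha]
    exact le_of_lt (mem_Ioi.1 hθ)
  set V := O ∩ S.F ⁻¹' (ReachFrom 1 P'ᶜ \ C) with hV
  have hVo : IsOpen V := hOo.inter
    ((isOpen_reach_diff_sees hPc' hPp' hP0').preimage S.F.continuous)
  have hOreach : ∀ z ∈ O, S.F z ∈ ReachFrom 1 P'ᶜ := by
    rintro z ⟨w, -, θ, -, ha⟩
    exact (S.mem_reach_image z).2 ha.reach
  have hVnull : volume (annProj '' V) = 0 := by
    have h1 : volume (annProj '' O) ≤ volume (annProj '' C) := by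
      calc volume (annProj '' O)
          ≤ volume (annProj '' C ∪ (Upper P \ Upper P')) := by
            refine measure_mono ?_
            rintro _ ⟨z, hz, rfl⟩
            by_cases hz' : z ∈ ReachFrom 1 P'ᶜ
            · exact Or.inl ⟨z, hOC ⟨hz, hz'⟩, rfl⟩
            · refine Or.inr ⟨?_, fun h => hz' (annProj_mem_upper.1 h)⟩
              obtain ⟨w, -, θ, -, ha⟩ := hz
              exact ⟨z, ha.reach, rfl⟩
        _ ≤ volume (annProj '' C) + volume (Upper P \ Upper P') := measure_union_le _ _
        _ = _ := by rw [S.measure_upper_diff hPc hPf, add_zero]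
    have h2 : volume (annProj '' C) = volume (annProj '' (S.F ⁻¹' C)) := by
      rw [← S.measure_image (annProj '' (S.F ⁻¹' C)), image_image]
      congr 1
      simp_rw [← S.proj]
      rw [← image_image annProj S.F, image_preimage_eq _ S.F.surjective]
    have h3 : volume (annProj '' V) + volume (annProj '' (S.F ⁻¹' C))
        ≤ volume (annProj '' O) := by
      rw [← measure_union' _ (isOpenMap_annProj _ hVo).measurableSet]
      · refine measure_mono (union_subset (image_mono inter_subset_left) (image_mono hCO))
      · rw [Set.disjoint_left]
        rintro _ ⟨z, hz, rfl⟩ ⟨z', hz', e⟩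
        refine hz.2.2 (Sees.of_proj_eq hz' ?_)
        rw [S.proj, S.proj, e]
    rw [← h2] at h3
    have h4 := h3.trans h1
    by_contra hpos
    exact (ENNReal.lt_add_right (measure_ne_top _ _) hpos).not_ge (by rwa [add_comm] at h4)
  have hVe : V = ∅ :=
    image_eq_empty.1 (eq_empty_of_null volume (isOpenMap_annProj _ hVo) hVnull)
  have hOsub : O ⊆ S.F ⁻¹' C := fun z hz => by
    by_contra hc
    have : z ∈ V := ⟨hz, hOreach z hz, hc⟩
    rw [hVe] at this; exact this
  by_contra! hθ
  have hzC : z ∈ C := ⟨w, hw, θ, hθ, h⟩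
  have hzO : S.F.symm z ∈ O := hCO (by simpa using hzC)
  obtain ⟨_, _, _, _, t, ht, γ, _, hγ, -⟩ := id hzO
  have hcl : IsClosed (γ ⁻¹' O) := by
    have e : γ ⁻¹' O = (γ ⁻¹' (S.F ⁻¹' (ReachFrom 1 P'ᶜ \ C)))ᶜ := by
      ext s
      have hr : S.F (γ s) ∈ ReachFrom 1 P'ᶜ :=
        (S.mem_reach_image _).2 (ReachFrom.path_mem ht γ hγ s)
      constructor
      · intro hs hs'; exact hs'.2 (hOsub hs)
      · intro hs; by_contra hc
        exact hs ⟨hr, fun h => hc (hCO h)⟩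
    rw [e]
    exact (((isOpen_reach_diff_sees hPc' hPp' hP0').preimage S.F.continuous).preimage
      γ.continuous).isClosed_compl
  have hun := IsClopen.eq_univ ⟨hcl, hOo.preimage γ.continuous⟩ ⟨1, by simpa using hzO⟩
  have ht0 : t ∈ O := by
    have : (0 : I) ∈ γ ⁻¹' O := hun ▸ mem_univ _
    simpa using this
  obtain ⟨w', hw', θ', hθ', ha'⟩ := ht0
  exact absurd (ha'.lt_of_top hPp hP0 ht hw') (not_lt.2 (le_of_lt hθ'))

end TwistSys

/-- The height of the set `D` above the point `x` of the circle. -/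
noncomputable def hgt (D : Set Ann) (x : 𝕋) : ℝ :=
  sSup (insert 0 {y : ℝ | ∃ u : UI, (x, u) ∈ D ∧ (u : ℝ) = y})

section hgt

variable {D : Set Ann}

lemma hgt_bddAbove (x : 𝕋) : BddAbove (insert 0 {y : ℝ | ∃ u : UI, (x, u) ∈ D ∧ (u : ℝ) = y}) := by
  refine ⟨1, ?_⟩
  rintro y (rfl | ⟨u, -, rfl⟩)
  · exact zero_le_one
  · exact u.2.2

lemma hgt_nonneg (x : 𝕋) : 0 ≤ hgt D x := le_csSup (hgt_bddAbove x) (mem_insert _ _)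

lemma hgt_le_one (x : 𝕋) : hgt D x ≤ 1 := by
  refine csSup_le (insert_nonempty _ _) ?_
  rintro y (rfl | ⟨u, -, rfl⟩)
  · exact zero_le_one
  · exact u.2.2

lemma le_hgt {x : 𝕋} {u : UI} (h : (x, u) ∈ D) : (u : ℝ) ≤ hgt D x :=
  le_csSup (hgt_bddAbove x) (mem_insert_of_mem _ ⟨u, h, rfl⟩)

lemma mem_of_lt_hgt (hdn : ∀ (x : 𝕋) (u v : UI), u ≤ v → (x, v) ∈ D → (x, u) ∈ D) {x : 𝕋}
    {u : UI} (h : (u : ℝ) < hgt D x) : (x, u) ∈ D := by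
  obtain ⟨y, hy, hlt⟩ := exists_lt_of_lt_csSup (insert_nonempty _ _) h
  rcases hy with rfl | ⟨v, hv, rfl⟩
  · exact absurd u.2.1 (not_le.2 hlt)
  · exact hdn x u v hlt.le hv

lemma eq_one_of_mem_of_eq_hgt (hD : IsOpen D) {a : Ann} (ha : a ∈ D)
    (h : (a.2 : ℝ) = hgt D a.1) : a.2 = 1 := by
  by_contra hne
  have hlt : (a.2 : ℝ) < 1 := lt_of_le_of_ne a.2.2.2 fun h => hne (Subtype.ext h)
  have hV : IsOpen {u : UI | (a.1, u) ∈ D} := hD.preimage (by fun_prop)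
  obtain ⟨r, hr, hb⟩ := Metric.isOpen_iff.1 hV a.2 ha
  have h0 := a.2.2.1
  let u : UI := ⟨min 1 (a.2 + r / 2), le_min zero_le_one (by linarith), min_le_left _ _⟩
  have hua : (a.2 : ℝ) < u := lt_min hlt (by linarith)
  have hu : u ∈ Metric.ball a.2 r := by
    rw [Metric.mem_ball, Subtype.dist_eq, Real.dist_eq, abs_of_pos (sub_pos.2 hua)]
    have : (u : ℝ) ≤ a.2 + r / 2 := min_le_right _ _
    linarith
  have := le_hgt (D := D) (x := a.1) (u := u) (hb hu)
  linarith

end hgt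

lemma continuous_of_lift_uniform {ψ : 𝕋 → ℝ}
    (h : ∀ ε > 0, ∃ δ > 0, ∀ x t : ℝ, 0 ≤ t → t < δ →
      ψ (x : 𝕋) - ε ≤ ψ ((x - t : ℝ) : 𝕋) ∧ ψ (x : 𝕋) - ε ≤ ψ ((x + t : ℝ) : 𝕋)) :
    Continuous ψ := by
  have hq : IsQuotientMap ((↑) : ℝ → 𝕋) := isQuotientMap_quotient_mk'
  rw [hq.continuous_iff, Metric.continuous_iff]
  intro x ε hε
  obtain ⟨δ, hδ, H⟩ := h (ε / 2) (half_pos hε)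
  refine ⟨δ, hδ, fun x' hx' => ?_⟩
  rw [Real.dist_eq] at hx' ⊢
  obtain ⟨h1, h2⟩ := abs_lt.1 hx'
  have e1 : x' - (x' - x) = x := by ring
  have e2 : x + (x' - x) = x' := by ring
  have e3 : x' + (x - x') = x := by ring
  have e4 : x - (x - x') = x' := by ring
  simp only [Function.comp]
  rw [abs_lt]
  rcases le_total x x' with hle | hle
  · have a := (H x' (x' - x) (by linarith) (by linarith)).1
    have b := (H x (x' - x) (by linarith) (by linarith)).2
    rw [e1] at a; rw [e2] at b
    constructor <;> linarith
  · have a := (H x' (x - x') (by linarith) (by linarith)).2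
    have b := (H x (x - x') (by linarith) (by linarith)).1
    rw [e3] at a; rw [e4] at b
    constructor <;> linarith

namespace TwistSys

variable (S : TwistSys) {D : Set Ann}

/-- Images of vertical segments with small horizontal extent have small vertical extent. -/
lemma vertical_modulus {ε : ℝ} (hε : 0 < ε) : ∃ δ > 0, ∀ (x : ℝ) (a b : UI), a ≤ b →
    (S.F (x, b)).1 - (S.F (x, a)).1 < δ →
    |((S.F (x, b)).2 : ℝ) - (S.F (x, a)).2| < ε := by
  let g : ℝ × UI × UI → ℝ := fun p => (S.F (p.1, p.2.2)).1 - (S.F (p.1, p.2.1)).1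
  let v : ℝ × UI × UI → ℝ := fun p => |((S.F (p.1, p.2.2)).2 : ℝ) - (S.F (p.1, p.2.1)).2|
  have hg : Continuous g := by fun_prop
  have hv : Continuous v := by fun_prop
  have hK : IsCompact ((Icc (0:ℝ) 1 ×ˢ univ) ∩ {p : ℝ × UI × UI | p.2.1 ≤ p.2.2 ∧ ε ≤ v p}) := by
    refine (isCompact_Icc.prod isCompact_univ).inter_right ?_
    exact (isClosed_le (by fun_prop) (by fun_prop)).inter (isClosed_le continuous_const hv)
  have hpos : ∀ p ∈ (Icc (0:ℝ) 1 ×ˢ univ) ∩ {p : ℝ × UI × UI | p.2.1 ≤ p.2.2 ∧ ε ≤ v p},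
      0 < g p := by
    rintro ⟨x, a, b⟩ ⟨-, hab, hvε⟩
    refine sub_pos.2 (S.twist x a b (lt_of_le_of_ne hab ?_))
    rintro rfl
    simp only [v, sub_self, abs_zero] at hvε
    linarith
  obtain ⟨δ, hδ, hmin⟩ : ∃ δ > 0, ∀ p ∈ (Icc (0:ℝ) 1 ×ˢ univ) ∩
      {p : ℝ × UI × UI | p.2.1 ≤ p.2.2 ∧ ε ≤ v p}, δ ≤ g p := by
    rcases eq_empty_or_nonempty ((Icc (0:ℝ) 1 ×ˢ univ) ∩
      {p : ℝ × UI × UI | p.2.1 ≤ p.2.2 ∧ ε ≤ v p}) with he | hne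
    · exact ⟨1, one_pos, by simp [he]⟩
    · obtain ⟨p, hp, hmin⟩ := hK.exists_isMinOn hne hg.continuousOn
      exact ⟨g p, hpos p hp, fun q hq => hmin hq⟩
  refine ⟨δ, hδ, fun x a b hab hlt => ?_⟩
  by_contra! hc
  have e : ∀ u : UI, ((Int.fract x, u) : StripA) = deckZ (-⌊x⌋) (x, u) := fun u => by
    simp [deckZ, Int.fract, sub_eq_add_neg]
  have hF : ∀ u : UI, S.F (Int.fract x, u) = ((S.F (x, u)).1 - ⌊x⌋, (S.F (x, u)).2) := fun u => by
    rw [e, F_deckZ]; simp [deckZ, sub_eq_add_neg]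
  have := hmin (Int.fract x, a, b) ⟨⟨⟨Int.fract_nonneg x, (Int.fract_lt_one x).le⟩, mem_univ _⟩,
    hab, by simpa [v, hF] using hc⟩
  simp only [g, hF] at this
  linarith

lemma hgt_left (hinv : ∀ a, S.f a ∈ D ↔ a ∈ D)
    (hdn : ∀ (x : 𝕋) (u v : UI), u ≤ v → (x, v) ∈ D → (x, u) ∈ D) {ε : ℝ} (hε : 0 < ε) :
    ∃ δ > 0, ∀ x t : ℝ, 0 ≤ t → t < δ → hgt D (x : 𝕋) - ε ≤ hgt D ((x - t : ℝ) : 𝕋) := by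
  obtain ⟨δ, hδ, H⟩ := S.vertical_modulus hε
  have hFD : ∀ z, annProj (S.F z) ∈ D ↔ annProj z ∈ D := fun z => by rw [S.proj, hinv]
  refine ⟨δ, hδ, fun x t ht0 htδ => ?_⟩
  rw [sub_le_iff_le_add]
  have hψ0 := hgt_nonneg (D := D) ((x - t : ℝ) : 𝕋)
  refine csSup_le (insert_nonempty _ _) ?_
  rintro y (rfl | ⟨u, hu, rfl⟩)
  · linarith
  set z' := S.F.symm (x, u) with hz'
  have hFz' : S.F (z'.1, z'.2) = (x, u) := S.F.apply_symm_apply _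
  have hDz' : ∀ s ≤ z'.2, annProj (S.F (z'.1, s)) ∈ D := fun s hs => by
    rw [hFD]
    refine hdn _ _ z'.2 hs ?_
    show annProj (z'.1, z'.2) ∈ D
    rw [← hFD, hFz']; exact hu
  rcases le_total (S.F (z'.1, 0)).1 (x - t) with hle | hle
  · have hc : ContinuousOn (fun s : UI => (S.F (z'.1, s)).1) (Icc 0 z'.2) := by fun_prop
    obtain ⟨s, hs, e⟩ := intermediate_value_Icc (show (0 : UI) ≤ z'.2 from z'.2.2.1) hc
      (show x - t ∈ Icc _ _ from ⟨hle, by simp only [hFz']; linarith⟩)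
    simp only at e
    have h1 := H z'.1 s z'.2 hs.2 (by rw [hFz', e]; simp only; linarith)
    have h2 := le_hgt (D := D) (hDz' s hs.2)
    simp only [e] at h2
    rw [hFz'] at h1
    have := (abs_lt.1 h1).2
    simp only at this
    linarith
  · have h1 := H z'.1 0 z'.2 z'.2.2.1 (by rw [hFz']; simp only; linarith)
    have h0 : (S.F (z'.1, 0)).2 = 0 := (S.bot _).2 rfl
    rw [hFz', h0] at h1
    have := (abs_lt.1 h1).2
    simp only [Icc.coe_zero] at this
    linarith

lemma continuous_hgt (hinv : ∀ a, S.f a ∈ D ↔ a ∈ D)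
    (hdn : ∀ (x : 𝕋) (u v : UI), u ≤ v → (x, v) ∈ D → (x, u) ∈ D) : Continuous (hgt D) := by
  refine continuous_of_lift_uniform fun ε hε => ?_
  obtain ⟨δ, hδ, H⟩ := S.hgt_left hinv hdn hε
  obtain ⟨δ', hδ', H'⟩ := S.refl.hgt_left (D := annFlipX ⁻¹' D) (fun a => by
    rw [refl_f, mem_preimage, mem_preimage]
    have i2 : ∀ z : Ann, annFlipX (annFlipX z) = z := fun z => by simp
    rw [i2, ← hinv, S.f.apply_symm_apply]) (fun x u v huv h => hdn (-x) u v huv h) hε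
  have e : ∀ x, hgt (annFlipX ⁻¹' D) x = hgt D (-x) := fun x => rfl
  refine ⟨min δ δ', lt_min hδ hδ', fun x t h0 ht => ⟨H x t h0 (ht.trans_le (min_le_left _ _)), ?_⟩⟩
  have := H' (-x) t h0 (ht.trans_le (min_le_right _ _))
  rw [e, e, ← AddCircle.coe_neg, ← AddCircle.coe_neg, neg_neg, neg_sub, sub_neg_eq_add,
    add_comm] at this
  exact this

lemma graph_invariant_aux (hD : IsOpen D) {g : Ann → Ann} (hg : Continuous g)
    (hinv : ∀ a, g a ∈ D ↔ a ∈ D) (hb : ∀ a, a.2 = 0 → (g a).2 = 0)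
    (ht : ∀ a, a.2 = 1 → (g a).2 = 1)
    (hdn : ∀ (x : 𝕋) (u v : UI), u ≤ v → (x, v) ∈ D → (x, u) ∈ D) (hψ : Continuous (hgt D))
    {a : Ann} (ha : (a.2 : ℝ) = hgt D a.1) : ((g a).2 : ℝ) = hgt D (g a).1 := by
  have hle : ((g a).2 : ℝ) ≤ hgt D (g a).1 := by
    by_cases h0 : a.2 = 0
    · rw [hb a h0]; exact hgt_nonneg _
    have hpos : 0 < (a.2 : ℝ) := lt_of_le_of_ne a.2.2.1 fun h => h0 (Subtype.ext h.symm)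
    have hcl : a ∈ closure D := by
      rw [Metric.mem_closure_iff]
      intro ε hε
      let u : UI := ⟨max 0 (a.2 - ε / 2), le_max_left _ _,
        max_le zero_le_one (by linarith [a.2.2.2])⟩
      have hua : (u : ℝ) < a.2 := max_lt hpos (by linarith)
      refine ⟨(a.1, u), mem_of_lt_hgt hdn (hua.trans_eq ha), ?_⟩
      rw [Prod.dist_eq, dist_self, Subtype.dist_eq, Real.dist_eq,
        abs_of_pos (sub_pos.2 hua)]
      have : (a.2 : ℝ) - ε / 2 ≤ u := le_max_right _ _
      exact max_lt hε (by linarith)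
    have hga : g a ∈ closure D := by
      refine closure_mono ?_ (image_closure_subset_closure_image hg (mem_image_of_mem g hcl))
      rintro _ ⟨b, hb', rfl⟩
      exact (hinv b).2 hb'
    have hsub : closure D ⊆ {b : Ann | (b.2 : ℝ) ≤ hgt D b.1} :=
      closure_minimal (fun b hb => le_hgt (D := D) (x := b.1) (u := b.2) hb)
        (isClosed_le (by fun_prop) (hψ.comp continuous_fst))
    exact hsub hga
  refine le_antisymm hle ?_
  by_contra! hlt
  have h1 := eq_one_of_mem_of_eq_hgt hD ((hinv a).1 (mem_of_lt_hgt hdn hlt)) ha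
  rw [ht a h1] at hlt
  exact absurd hlt (not_lt.2 (hgt_le_one _))

/-- An invariant open set which is a union of vertical segments based on the bottom circle
contains the annulus minus its top circle. -/
theorem mem_of_lower (hD : IsOpen D) (hinv : ∀ a, S.f a ∈ D ↔ a ∈ D)
    (hdn : ∀ (x : 𝕋) (u v : UI), u ≤ v → (x, v) ∈ D → (x, u) ∈ D) (hne : D.Nonempty)
    {a : Ann} (ha : a.2 ≠ 1) : a ∈ D := by
  have hψ := S.continuous_hgt hinv hdn
  rcases S.noGraph (hgt D) hψ (fun x => ⟨hgt_nonneg x, hgt_le_one x⟩) (by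
    refine Subset.antisymm ?_ fun b hb => ⟨S.f.symm b, ?_, S.f.apply_symm_apply b⟩
    · rintro _ ⟨b, hb, rfl⟩
      exact graph_invariant_aux hD S.f.continuous hinv (fun a => (S.ann_bot a).2)
        (fun a => (S.ann_top a).2) hdn hψ hb
    · refine graph_invariant_aux hD S.f.symm.continuous (fun a => ?_) (fun a h => ?_)
        (fun a h => ?_) hdn hψ hb
      · rw [← hinv, S.f.apply_symm_apply]
      · rwa [← S.ann_bot, S.f.apply_symm_apply]
      · rwa [← S.ann_top, S.f.apply_symm_apply]) with h | h
  · obtain ⟨b, hb⟩ := hne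
    have h0 : ((b.1, 0) : Ann) ∈ D := hdn b.1 0 b.2 b.2.2.1 hb
    have h1 : hgt D b.1 = 0 := by
      by_contra hc
      have : ((b.1, ⟨hgt D b.1, hgt_nonneg _, hgt_le_one _⟩) : Ann) ∈ C0 := by
        rw [← h]; rfl
      exact hc this
    exact absurd (eq_one_of_mem_of_eq_hgt hD h0 (by simp [h1])) zero_ne_one
  · have : ((a.1, 1) : Ann) ∈ {z : Ann | (z.2 : ℝ) = hgt D z.1} := by
      rw [h]; exact mem_C1.2 rfl
    refine mem_of_lt_hgt hdn (x := a.1) (u := a.2) ?_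
    rw [← (this : _ = hgt D a.1)]
    exact lt_of_le_of_ne a.2.2.2 fun h => ha (Subtype.ext h)

/-- An invariant open set which is a union of vertical segments hanging from the top circle
contains the annulus minus its bottom circle. -/
theorem mem_of_upper (hD : IsOpen D) (hinv : ∀ a, S.f a ∈ D ↔ a ∈ D)
    (hup : ∀ (x : 𝕋) (u v : UI), u ≤ v → (x, u) ∈ D → (x, v) ∈ D) (hne : D.Nonempty)
    {a : Ann} (ha : a.2 ≠ 0) : a ∈ D := by
  have i2 : ∀ z : Ann, annFlipY (annFlipY z) = z := fun z => by simp
  have := S.dual.mem_of_lower (D := annFlipY ⁻¹' D) (hD.preimage annFlipY.continuous)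
    (fun a => by
      rw [dual_f, mem_preimage, mem_preimage, i2, ← hinv, S.f.apply_symm_apply])
    (fun x u v huv h => hup x _ _ (unitInterval.strictAnti_symm.antitone huv) h)
    (hne.preimage annFlipY.surjective) (a := annFlipY a) (by simpa using ha)
  rwa [mem_preimage, i2] at this

end TwistSys

section continua

variable {X : Type*} [TopologicalSpace X]

lemma exists_subset_of_iInter_subset [T2Space X] {K : ℕ → Set X} (hK : Antitone K)
    (hc : ∀ n, IsCompact (K n)) {U : Set X} (hU : IsOpen U) (h : ⋂ n, K n ⊆ U) :
    ∃ n, K n ⊆ U :=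
  exists_subset_nhds_of_isCompact hK.directed_ge hc fun _ hx => hU.mem_nhds (h hx)

/-- A decreasing intersection of continua is connected. -/
lemma isPreconnected_iInter_of_antitone [T2Space X] {K : ℕ → Set X} (hK : Antitone K)
    (hc : ∀ n, IsCompact (K n)) (hp : ∀ n, IsPreconnected (K n)) :
    IsPreconnected (⋂ n, K n) := by
  intro U V hU hV hsub hnU hnV
  by_contra he
  have hcK : IsCompact (⋂ n, K n) :=
    (hc 0).of_isClosed_subset (isClosed_iInter fun n => (hc n).isClosed) (iInter_subset _ 0)
  obtain ⟨U', V', hU', hV', hsU, hsV, hd⟩ :=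
    SeparatedNhds.of_isCompact_isCompact (hcK.diff hV) (hcK.diff hU) (by
      rw [Set.disjoint_left]
      rintro x ⟨hx, h1⟩ ⟨-, h2⟩
      exact (hsub hx).elim h2 h1)
  have h1 : ∀ x ∈ ⋂ n, K n, x ∈ U → x ∈ U' := fun x hx hxU =>
    hsU ⟨hx, fun hxV => he ⟨x, hx, hxU, hxV⟩⟩
  have h2 : ∀ x ∈ ⋂ n, K n, x ∈ V → x ∈ V' := fun x hx hxV =>
    hsV ⟨hx, fun hxU => he ⟨x, hx, hxU, hxV⟩⟩
  obtain ⟨n, hn⟩ := exists_subset_of_iInter_subset hK hc (hU'.union hV') (fun x hx =>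
    (hsub hx).imp (h1 x hx) (h2 x hx))
  obtain ⟨u, hu, huU⟩ := hnU
  obtain ⟨v, hv, hvV⟩ := hnV
  obtain ⟨x, -, hx⟩ := hp n U' V' hU' hV' hn ⟨u, mem_iInter.1 hu n, h1 u hu huU⟩
    ⟨v, mem_iInter.1 hv n, h2 v hv hvV⟩
  exact hd.le_bot hx

lemma isClosed_connectedComponentIn {Y : Set X} (hY : IsClosed Y) (p : X) :
    IsClosed (connectedComponentIn Y p) := by
  by_cases hp : p ∈ Y
  · refine isClosed_of_closure_subset ?_
    exact isPreconnected_connectedComponentIn.closure.subset_connectedComponentIn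
      (subset_closure (mem_connectedComponentIn hp))
      (closure_minimal (connectedComponentIn_subset _ _) hY)
  · rw [connectedComponentIn_eq_empty hp]; exact isClosed_empty

/-- Boundary bumping: a component of a proper closed sublevel in a continuum reaches the
boundary of the sublevel. -/
lemma exists_mem_component_ge [T2Space X] {K : Set X} (hKc : IsCompact K) (hKp : IsPreconnected K)
    {φ : X → ℝ} (hφ : Continuous φ) {h : ℝ} {p : X} (hp : p ∈ K) (hph : φ p ≤ h)
    (hex : ∃ x ∈ K, h < φ x) : ∃ x ∈ connectedComponentIn (K ∩ {x | φ x ≤ h}) p, h ≤ φ x := by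
  by_contra! hlt
  set Y := K ∩ {x | φ x ≤ h} with hY
  have hYc : IsCompact Y := hKc.inter_right (isClosed_le hφ continuous_const)
  have : CompactSpace Y := isCompact_iff_compactSpace.1 hYc
  have hpY : p ∈ Y := ⟨hp, hph⟩
  rw [connectedComponentIn_eq_image hpY, connectedComponent_eq_iInter_isClopen] at hlt
  obtain ⟨⟨Z, hZ, hpZ⟩, hZs⟩ : ∃ s : {s : Set Y // IsClopen s ∧ (⟨p, hpY⟩ : Y) ∈ s},
      (s : Set Y) ⊆ {y | φ y < h} := by
    have : Nonempty {s : Set Y // IsClopen s ∧ (⟨p, hpY⟩ : Y) ∈ s} :=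
      ⟨⟨univ, isClopen_univ, mem_univ _⟩⟩
    refine exists_subset_nhds_of_compactSpace ?_ (fun s => s.2.1.1) fun x hx => ?_
    · intro s t
      exact ⟨⟨s.1 ∩ t.1, s.2.1.inter t.2.1, s.2.2, t.2.2⟩, inter_subset_left, inter_subset_right⟩
    · exact (isOpen_lt (hφ.comp continuous_subtype_val) continuous_const).mem_nhds
        (hlt x ⟨x, hx, rfl⟩)
  obtain ⟨W, hW, rfl⟩ := isOpen_induced_iff.1 hZ.2
  have hcl : IsClosed ((↑) '' ((↑) ⁻¹' W : Set Y) : Set X) :=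
    (hZ.1.isCompact.image continuous_subtype_val).isClosed
  obtain ⟨x, hx, hxh⟩ := hex
  obtain ⟨y, hyK, ⟨hyW, hyh⟩, hyn⟩ := hKp (W ∩ {x | φ x < h}) _
    (hW.inter (isOpen_lt hφ continuous_const)) hcl.isOpen_compl (fun y hy => by
      by_cases hyc : y ∈ ((↑) '' ((↑) ⁻¹' W : Set Y) : Set X)
      · obtain ⟨y', hy', rfl⟩ := hyc
        exact Or.inl ⟨hy', hZs hy'⟩
      · exact Or.inr hyc) ⟨p, hp, hpZ, hZs hpZ⟩ ⟨x, hx, by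
        rintro ⟨y, -, rfl⟩
        exact absurd y.2.2 (not_le.2 hxh)⟩
  exact hyn ⟨⟨y, hyK, (show φ y ≤ h from le_of_lt hyh)⟩, hyW, rfl⟩

end continua

namespace TwistSys

variable {S : TwistSys} {P : Set Ann} {z w : StripA} {θ : ℝ}

lemma Ang.refl_swap (h : S.Ang P z w θ) :
    S.refl.Ang (annFlipX ⁻¹' (S.f '' P)) (stripFlipX (S.F z)) (stripFlipX (S.F w))
      (3 * Real.pi / 2 - θ) := by
  obtain ⟨t, ht, γ, L, hγ, hL, hL0, rfl⟩ := h
  have hF : Continuous fun u => stripFlipX (S.F u) := stripFlipX.continuous.comp S.F.continuous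
  have hd : ∀ u v, S.refl.disp (stripFlipX (S.F u)) (stripFlipX (S.F v)) =
      ⟨-(S.disp u v).im, -(S.disp u v).re⟩ := fun u v => by
    apply Complex.ext <;> simp [disp, refl_F] <;> ring
  refine ⟨stripFlipX (S.F t), (S.top t).2 ht, γ.map hF,
    ⟨fun s => 3 * Real.pi / 2 - L s, by fun_prop⟩, fun s => ?_, fun s => ?_, ?_, rfl⟩
  · show annProj (stripFlipX (S.F (γ s))) ∉ _
    have i2 : ∀ z : Ann, annFlipX (annFlipX z) = z := fun z => by simp
    rw [annProj_flipX, mem_preimage, i2, S.proj_image]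
    exact hγ s
  · show IsAng (S.refl.disp (stripFlipX (S.F (γ s))) _) _
    rw [hd]
    exact (hL s).neg_swap
  · simp only [ContinuousMap.coe_mk]
    exact ⟨by linarith [hL0.2], by linarith [hL0.1]⟩

lemma Ang.mem_Ioo_of_invariant (hPc : IsClosed P) (hPp : IsPreconnected P) (hP0 : C0 ⊆ P)
    (hPf : S.f '' P = P) (hw : annProj w ∈ P) (h : S.Ang P z w θ) :
    θ ∈ Ioo 0 (3 * Real.pi / 2) := by
  constructor
  · have h1 := h.refl_swap
    have hr : S.refl.f '' (annFlipX ⁻¹' P) = annFlipX ⁻¹' P := by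
      ext a
      rw [← Homeomorph.symm_symm S.refl.f, Homeomorph.image_symm, mem_preimage, refl_f_symm]
      conv_lhs => rw [mem_preimage]
      have i2 : ∀ z : Ann, annFlipX (annFlipX z) = z := fun z => by simp
      rw [i2]
      conv_lhs => rw [← hPf]
      rw [S.f.injective.mem_set_image, mem_preimage]
    rw [hPf, ← hr] at h1
    have := h1.lt_of_expanding (hPc.preimage annFlipX.continuous)
      (annFlipX.isPreconnected_preimage.2 hPp) (fun a ha => hP0 ha) hr.superset (by
        rw [hr, annProj_flipX, mem_preimage]
        have i2 : ∀ z : Ann, annFlipX (annFlipX z) = z := fun z => by simp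
        rw [i2, ← hPf, S.proj_image]; exact hw)
    linarith
  · rw [← hPf] at h
    exact h.lt_of_expanding hPc hPp hP0 hPf.superset (hPf.superset hw)

/-- An invariant continuum containing the bottom circle and not touching the top circle is
the bottom circle. -/
theorem subset_C0_of_invariant (hPc : IsClosed P) (hPp : IsPreconnected P) (hP0 : C0 ⊆ P)
    (hPf : S.f '' P = P) (hP1 : ∀ a ∈ P, a.2 ≠ 1) : P ⊆ C0 := by
  intro a ha
  by_contra h0
  refine upper_subset (P := P) (S.mem_of_upper (D := Upper P) (isOpen_upper hPc) (fun a => ?_)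
    ?_ ⟨annProj (0, 1), ?_⟩ (fun h => h0 (mem_C0.2 h))) ha
  · conv_lhs => rw [← hPf, upper_image]
    exact S.f.injective.mem_set_image
  · intro x u v huv hu
    obtain ⟨⟨x, u⟩, hz, e⟩ := id hu
    obtain ⟨rfl, rfl⟩ := Prod.ext_iff.1 e
    have hoff : ∀ y, u ≤ y → annProj (x, y) ∈ Pᶜ := fun y hy hyP => by
      rcases hy.eq_or_lt with rfl | hy
      · exact ReachFrom.proj_mem hz hyP
      obtain ⟨θ, hθ⟩ := exists_ang (S := S) hz hyP
      have hI := hθ.mem_Ioo_of_invariant hPc hPp hP0 hPf hyP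
      have hd := S.disp_of_down x hy
      have := hθ.isAng.le_of_down hd.1 hd.2 hI.2
      linarith [hI.1, Real.pi_pos]
    refine ⟨(x, v), ReachFrom.extend hz (segPath (x, u) (x, v)) fun s => ?_, rfl⟩
    have h1 : (segPath (x, u) (x, v) s).1 = x := by rw [segPath_apply_fst]; ring
    have h2 : u ≤ (segPath (x, u) (x, v) s).2 := by
      rw [← Subtype.coe_le_coe, segPath_apply_snd]
      have := s.2.1
      have : (u : ℝ) ≤ v := huv
      simp only
      nlinarith
    have := hoff _ h2
    rwa [← h1] at this
  · exact ⟨_, reachFrom_self (fun h => hP1 _ h rfl) rfl, rfl⟩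

end TwistSys

lemma isPreconnected_C0 : IsPreconnected C0 := by
  have : C0 = univ ×ˢ {(0 : UI)} := by ext a; simp [mem_C0]
  rw [this]
  exact isPreconnected_univ.prod isPreconnected_singleton

lemma continuous_height : Continuous fun a : Ann => (a.2 : ℝ) :=
  continuous_subtype_val.comp continuous_snd

lemma exists_collar {O : Set Ann} (hO : IsOpen O) (h : C0 ⊆ O) :
    ∃ c : UI, 0 < c ∧ ∀ a : Ann, a.2 ≤ c → a ∈ O := by
  rcases Oᶜ.eq_empty_or_nonempty with he | hne
  · exact ⟨1, by norm_num, fun a _ => by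
      by_contra ha
      exact he.subset ha⟩
  · obtain ⟨b, hb, hmin⟩ := hO.isClosed_compl.isCompact.exists_isMinOn hne
      (continuous_height.continuousOn)
    have hb0 : 0 < (b.2 : ℝ) := b.2.2.1.lt_of_ne fun e => hb (h e.symm)
    refine ⟨⟨b.2 / 2, by linarith, by linarith [b.2.2.2]⟩, ?_, fun a ha => ?_⟩
    · show (0 : ℝ) < b.2 / 2
      linarith
    · by_contra hc
      have h1 : (b.2 : ℝ) ≤ a.2 := hmin hc
      have h2 : (a.2 : ℝ) ≤ b.2 / 2 := ha
      linarith

lemma mem_upper_of_height {P : Set Ann} {ε : ℝ} (hP : ∀ a ∈ P, (a.2 : ℝ) < ε) {a : Ann}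
    (ha : ε ≤ (a.2 : ℝ)) : a ∈ Upper P := by
  obtain ⟨z, rfl⟩ := annProj_surjective a
  have hz : ε ≤ (z.2 : ℝ) := ha
  have h1 : (z.1, (1 : UI)) ∈ ReachFrom 1 Pᶜ :=
    reachFrom_self (fun h => absurd (hP _ h) (not_lt.2 (ha.trans z.2.2.2))) rfl
  rw [annProj_mem_upper]
  refine ReachFrom.extend h1 (segPath _ z) fun s h => absurd (hP _ h) (not_lt.2 ?_)
  show ε ≤ ((segPath (z.1, (1 : UI)) z s).2 : ℝ)
  rw [segPath_apply_snd]
  have := s.2.1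
  have := s.2.2
  have := z.2.2.2
  have e : ((1 : UI) : ℝ) = 1 := rfl
  simp only [e]
  nlinarith

lemma eq_empty_of_subset_C0 {V : Set Ann} (hV : IsOpen V) (h : V ⊆ C0) : V = ∅ := by
  by_contra hne
  obtain ⟨⟨x, y⟩, ha⟩ := nonempty_iff_ne_empty.2 hne
  have hO : IsOpen ((fun y : UI => ((x, y) : Ann)) ⁻¹' V) :=
    hV.preimage (Continuous.prodMk_right x)
  have e : (fun y : UI => ((x, y) : Ann)) ⁻¹' V = {0} := by
    refine subset_antisymm (fun y hy => mem_C0.1 (h hy)) ?_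
    rintro _ rfl
    have : y = 0 := mem_C0.1 (h ha)
    subst this
    exact ha
  rw [e] at hO
  rcases isClopen_iff.1 ⟨isClosed_singleton, hO⟩ with h0 | h0
  · exact singleton_ne_empty _ h0
  · have : (1 : UI) ∈ ({0} : Set UI) := h0 ▸ mem_univ _
    exact one_ne_zero this

namespace TwistSys

variable (S : TwistSys)

lemma C0_subset_iterate {g : Ann ≃ₜ Ann} (hb : ∀ a, (g a).2 = 0 ↔ a.2 = 0) {K : Set Ann}
    (hK : C0 ⊆ K) (n : ℕ) : C0 ⊆ g^[n] '' K := by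
  induction n with
  | zero => simpa using hK
  | succ n ih =>
    rw [Function.iterate_succ', image_comp]
    intro a ha
    refine ⟨g.symm a, ih (mem_C0.2 ?_), g.apply_symm_apply a⟩
    rw [← hb, g.apply_symm_apply]
    exact mem_C0.1 ha

lemma antitone_iterate_image {α : Type*} {g : α → α} {K : Set α} (h : g '' K ⊆ K) :
    Antitone fun n : ℕ => g^[n] '' K :=
  antitone_nat_of_succ_le fun n => by
    simp only [Function.iterate_succ, image_comp]
    exact image_mono h

/-- A continuum containing the bottom circle which is mapped into itself by the map or by its
inverse shrinks to the bottom circle. -/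
lemma exists_iterate_subset {g : Ann ≃ₜ Ann} (hb : ∀ a, (g a).2 = 0 ↔ a.2 = 0)
    (hinv : ∀ K, g '' K = K → S.f '' K = K) {K : Set Ann} (hKc : IsClosed K)
    (hKp : IsPreconnected K) (hK0 : C0 ⊆ K) (hgK : g '' K ⊆ K) (hK1 : ∀ a ∈ K, a.2 ≠ 1)
    {ε : ℝ} (hε : 0 < ε) : ∃ n : ℕ, ∀ a ∈ g^[n] '' K, (a.2 : ℝ) < ε := by
  have hanti := antitone_iterate_image hgK
  have hcomp : ∀ n, IsCompact (g^[n] '' K) := fun n =>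
    hKc.isCompact.image (g.continuous.iterate n)
  have hpre : ∀ n, IsPreconnected (g^[n] '' K) := fun n =>
    hKp.image _ (g.continuous.iterate n).continuousOn
  have hI : g '' (⋂ n : ℕ, g^[n] '' K) = ⋂ n : ℕ, g^[n] '' K := by
    rw [image_iInter g.bijective]
    simp only [← image_comp, ← Function.iterate_succ']
    refine subset_antisymm (subset_iInter fun n => (iInter_subset _ n).trans
      (hanti (Nat.le_succ n))) (subset_iInter fun n => iInter_subset _ (n + 1))
  have hC : ⋂ n : ℕ, g^[n] '' K ⊆ C0 := by
    refine S.subset_C0_of_invariant (isClosed_iInter fun n => (hcomp n).isClosed)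
      (isPreconnected_iInter_of_antitone hanti hcomp hpre)
      (subset_iInter fun n => C0_subset_iterate hb hK0 n) (hinv _ hI) fun a ha => ?_
    exact hK1 a (by simpa using mem_iInter.1 ha 0)
  exact exists_subset_of_iInter_subset hanti hcomp
    (isOpen_lt continuous_height continuous_const : IsOpen {a : Ann | (a.2 : ℝ) < ε})
    fun a ha => by
      have : (a.2 : ℝ) = 0 := hC ha
      show (a.2 : ℝ) < ε
      rw [this]; exact hε

lemma symm_bot (a : Ann) : (S.f.symm a).2 = 0 ↔ a.2 = 0 := by
  rw [← S.ann_bot, S.f.apply_symm_apply]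

lemma symm_iterate_bot (n : ℕ) {a : Ann} (h : a ∈ C0) : S.f.symm^[n] a ∈ C0 := by
  induction n with
  | zero => exact h
  | succ n ih =>
    rw [Function.iterate_succ_apply', mem_C0, symm_bot]
    exact mem_C0.1 ih

lemma iterate_bot (n : ℕ) {a : Ann} (h : a ∈ C0) : S.f^[n] a ∈ C0 := by
  induction n with
  | zero => exact h
  | succ n ih =>
    rw [Function.iterate_succ_apply', mem_C0, ann_bot]
    exact mem_C0.1 ih

lemma measure_iterate_image (n : ℕ) (s : Set Ann) : volume (S.f^[n] '' s) = volume s := by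
  induction n with
  | zero => simp
  | succ n ih => rw [Function.iterate_succ', image_comp, measure_image, ih]

/-- Some iterate of a collar of the bottom circle reaches above height `1/2`. -/
lemma exists_iterate_collar {c : UI} (hc : 0 < c) :
    ∃ m : ℕ, ∃ a : Ann, a.2 ≤ c ∧ (1 / 2 : ℝ) < (S.f^[m] a).2 := by
  by_contra! hall
  set R : Set Ann := {a | a.2 ≤ c}
  have hR0 : C0 ⊆ R := fun a ha => by
    show a.2 ≤ c
    rw [mem_C0.1 ha]; exact hc.le
  have hRp : IsPreconnected R := by
    have : R = univ ×ˢ Iic c := by ext; simp [R]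
    rw [this]
    exact isPreconnected_univ.prod isPreconnected_Iic
  set K := closure (⋃ m : ℕ, S.f^[m] '' R) with hK
  have hKhalf : K ⊆ {a | (a.2 : ℝ) ≤ 1 / 2} :=
    closure_minimal (iUnion_subset fun m => by
      rintro _ ⟨a, ha, rfl⟩
      exact hall m a ha) (isClosed_le continuous_height continuous_const)
  have hsub : ∀ m, S.f^[m] '' R ⊆ K := fun m =>
    (subset_iUnion (fun m : ℕ => S.f^[m] '' R) m).trans subset_closure
  have hR : R ⊆ K := by simpa using hsub 0
  have hKp : IsPreconnected K := by
    refine (isPreconnected_iUnion ⟨((0 : 𝕋), (0 : UI)), mem_iInter.2 fun m => ?_⟩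
      fun m => hRp.image _ (S.f.continuous.iterate m).continuousOn).closure
    exact C0_subset_iterate S.ann_bot hR0 m rfl
  have hfK : S.f '' K ⊆ K := by
    refine (image_closure_subset_closure_image S.f.continuous).trans (closure_mono ?_)
    rw [image_iUnion]
    refine iUnion_subset fun m => ?_
    rw [← image_comp, ← Function.iterate_succ']
    exact subset_iUnion (fun m : ℕ => S.f^[m] '' R) (m + 1)
  have hc0 : (0 : ℝ) < c := hc
  obtain ⟨n, hn⟩ := S.exists_iterate_subset S.ann_bot (fun _ h => h) isClosed_closure hKp
    (hR0.trans hR) hfK (fun a ha h1 => by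
      have h2 : (a.2 : ℝ) ≤ 1 / 2 := hKhalf ha
      rw [h1] at h2
      norm_num at h2) (half_pos hc0)
  set V : Set Ann := {a | (c / 2 : ℝ) < a.2 ∧ (a.2 : ℝ) < c}
  have hVo : IsOpen V := (isOpen_lt continuous_const continuous_height).inter
    (isOpen_lt continuous_height continuous_const)
  have hV0 : volume V = 0 := by
    have hd : Disjoint V (S.f^[n] '' K) := by
      rw [Set.disjoint_left]
      exact fun a ha hb => lt_asymm ha.1 (hn a hb)
    have hm : MeasurableSet (S.f^[n] '' K) :=
      (isClosed_closure.isCompact.image (S.f.continuous.iterate n)).isClosed.measurableSet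
    have hs : V ∪ S.f^[n] '' K ⊆ K := by
      refine union_subset (fun a ha => hR ha.2.le) ?_
      have := antitone_iterate_image hfK (Nat.zero_le n)
      simpa using this
    have h1 := measure_mono (μ := volume) hs
    rw [measure_union hd hm, measure_iterate_image] at h1
    by_contra hne
    exact absurd h1 (not_le.2 (by
      rw [add_comm]
      exact ENNReal.lt_add_right (measure_ne_top _ _) hne))
  have hVe := eq_empty_of_null volume hVo hV0
  have : ((0 : 𝕋), (⟨3 * c / 4, by linarith, by linarith [c.2.2]⟩ : UI)) ∈ V := by
    constructor <;> simp only <;> linarith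
  rw [hVe] at this
  exact this

lemma symm_iterate_iterate {k m : ℕ} (h : k ≤ m) (a : Ann) :
    S.f.symm^[k] (S.f^[m] a) = S.f^[m - k] a := by
  obtain ⟨j, rfl⟩ := Nat.exists_eq_add_of_le h
  rw [Function.iterate_add_apply, Nat.add_sub_cancel_left]
  exact S.f.left_inv.iterate k _

/-- There is a continuum containing the bottom circle strictly, contained in the lower half
annulus and in its own image. -/
lemma exists_continuum : ∃ X : Set Ann, IsClosed X ∧ IsPreconnected X ∧ C0 ⊆ X ∧
    (∀ a ∈ X, (a.2 : ℝ) ≤ 1 / 2) ∧ S.f.symm '' X ⊆ X ∧ ∃ a ∈ X, a.2 ≠ 0 := by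
  set p : Ann := ((0 : 𝕋), (0 : UI))
  have hp : p ∈ C0 := rfl
  set Y : ℕ → Set Ann := fun n => {a | ∀ k ≤ n, ((S.f.symm^[k] a).2 : ℝ) ≤ 1 / 2} with hY
  have hYc : ∀ n, IsClosed (Y n) := fun n => by
    simp only [hY, ofPred_forall]
    exact isClosed_iInter fun k => isClosed_iInter fun _ =>
      isClosed_le (continuous_height.comp (S.f.symm.continuous.iterate k)) continuous_const
  have hYa : Antitone Y := fun m n hmn a ha k hk => ha k (hk.trans hmn)
  have hY0 : ∀ n, C0 ⊆ Y n := fun n a ha k _ => by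
    have : ((S.f.symm^[k] a).2 : ℝ) = 0 := S.symm_iterate_bot k ha
    rw [this]; norm_num
  set B : ℕ → Set Ann := fun n => connectedComponentIn (Y n) p with hB
  have hB0 : ∀ n, C0 ⊆ B n := fun n =>
    isPreconnected_C0.subset_connectedComponentIn hp (hY0 n)
  have hBa : Antitone B := fun m n hmn => connectedComponentIn_mono p (hYa hmn)
  have hBc : ∀ n, IsClosed (B n) := fun n => isClosed_connectedComponentIn (hYc n) p
  have hBx : ∀ n, ∃ x ∈ B n, (1 / 2 : ℝ) ≤ x.2 := fun n => by
    obtain ⟨c, hc, hcO⟩ := exists_collar (O := ⋂ j ∈ Finset.range (n + 1),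
      {a : Ann | ((S.f^[j] a).2 : ℝ) < 1 / 2})
      (isOpen_biInter_finset fun j _ =>
        isOpen_lt (continuous_height.comp (S.f.continuous.iterate j)) continuous_const)
      (fun a ha => by
        simp only [mem_iInter]
        intro j _
        have : ((S.f^[j] a).2 : ℝ) = 0 := S.iterate_bot j ha
        show ((S.f^[j] a).2 : ℝ) < 1 / 2
        rw [this]; norm_num)
    have hex := S.exists_iterate_collar hc
    classical
    set m := Nat.find hex
    have hmin : ∀ j < m, ∀ a : Ann, a.2 ≤ c → ((S.f^[j] a).2 : ℝ) ≤ 1 / 2 := fun j hj a ha => by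
      by_contra! h
      exact Nat.find_min hex hj ⟨a, ha, h⟩
    obtain ⟨a, hac, ham⟩ : ∃ a : Ann, a.2 ≤ c ∧ (1 / 2 : ℝ) < (S.f^[m] a).2 := Nat.find_spec hex
    have hnm : n < m := by
      by_contra! h
      have h1 := mem_iInter₂.1 (hcO a hac) m (Finset.mem_range.2 (by omega))
      exact lt_asymm ham h1
    set R : Set Ann := {a | a.2 ≤ c}
    have hR0 : C0 ⊆ R := fun a ha => by
      show a.2 ≤ c
      rw [mem_C0.1 ha]; exact hc.le
    have hRp : IsPreconnected R := by
      have : R = univ ×ˢ Iic c := by ext; simp [R]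
      rw [this]
      exact isPreconnected_univ.prod isPreconnected_Iic
    have hRc : IsCompact R := (isClosed_le continuous_snd continuous_const).isCompact
    obtain ⟨x, hx, hx2⟩ := exists_mem_component_ge
      (hRc.image (S.f.continuous.iterate m)) (hRp.image _ (S.f.continuous.iterate m).continuousOn)
      continuous_height (h := 1 / 2) (C0_subset_iterate S.ann_bot hR0 m hp)
      (by simp [p]) ⟨_, ⟨a, hac, rfl⟩, ham⟩
    refine ⟨x, connectedComponentIn_mono p ?_ hx, hx2⟩
    rintro _ ⟨⟨b, hb, rfl⟩, hb2⟩ k hk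
    rcases k.eq_zero_or_pos with rfl | hk0
    · exact hb2
    · rw [S.symm_iterate_iterate (hk.trans hnm.le)]
      exact hmin _ (by omega) b hb
  refine ⟨⋂ n, B n, isClosed_iInter hBc, isPreconnected_iInter_of_antitone hBa
    (fun n => (hBc n).isCompact) (fun n => isPreconnected_connectedComponentIn),
    subset_iInter hB0, fun a ha => ?_, ?_, ?_⟩
  · exact connectedComponentIn_subset _ _ (mem_iInter.1 ha 0) 0 le_rfl
  · rintro _ ⟨a, ha, rfl⟩
    refine mem_iInter.2 fun n => ?_
    have hpre : IsPreconnected (S.f.symm '' B (n + 1)) :=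
      isPreconnected_connectedComponentIn.image _ S.f.symm.continuous.continuousOn
    refine hpre.subset_connectedComponentIn ?_ ?_ ⟨a, mem_iInter.1 ha (n + 1), rfl⟩
    · exact ⟨S.f p, hB0 _ (S.iterate_bot 1 hp), S.f.symm_apply_apply p⟩
    · rintro _ ⟨b, hb, rfl⟩ k hk
      have := connectedComponentIn_subset _ _ hb (k + 1) (by omega)
      rwa [Function.iterate_succ_apply] at this
  · obtain ⟨x, hx⟩ := IsCompact.nonempty_iInter_of_sequence_nonempty_isCompact_isClosed
      (fun n => B n ∩ {a | (1 / 2 : ℝ) ≤ a.2})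
      (fun n => inter_subset_inter_left _ (hBa (Nat.le_succ n)))
      (fun n => (hBx n).imp fun x hx => hx)
      ((hBc 0).inter (isClosed_le continuous_const continuous_height)).isCompact
      (fun n => (hBc n).inter (isClosed_le continuous_const continuous_height))
    have hx' := mem_iInter.1 hx
    refine ⟨x, mem_iInter.2 fun n => (hx' n).1, fun h0 => ?_⟩
    have h2 : (1 / 2 : ℝ) ≤ x.2 := (hx' 0).2
    rw [h0] at h2
    norm_num at h2

/-- An increasing sequence of continua, each the image of the preceding one, made of points
whose backward orbit converges to the bottom circle. -/
structure Unstable (P : ℕ → Set Ann) : Prop where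
  closed : ∀ n, IsClosed (P n)
  preconnected : ∀ n, IsPreconnected (P n)
  bot_subset : ∀ n, C0 ⊆ P n
  succ : ∀ n, P (n + 1) = S.f '' P n
  mono : Monotone P
  ne_top : ∀ n, ∀ a ∈ P n, a.2 ≠ 1
  nontrivial : ∃ a ∈ P 0, a.2 ≠ 0
  dense : Dense (⋂ n, Upper (P n))
  tendsto : ∀ n, ∀ a ∈ P n, Tendsto (fun k : ℕ => ((S.f.symm^[k] a).2 : ℝ)) atTop (𝓝 0)

lemma symm_image_image (s : Set Ann) : S.f '' (S.f.symm '' s) = s := by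
  rw [S.f.image_symm, S.f.image_preimage]

lemma dense_upper {X : Set Ann} (hc : IsClosed X) (hX : S.f.symm '' X ⊆ X)
    (hs : ∀ ε : ℝ, 0 < ε → ∃ k : ℕ, ∀ a ∈ S.f.symm^[k] '' X, (a.2 : ℝ) < ε) :
    Dense (Upper X) := by
  have hnull : ∀ k : ℕ, volume (Upper (S.f.symm^[k] '' X) \ Upper X) = 0 := fun k => by
    induction k with
    | zero => simp
    | succ k ih =>
      have hck : IsClosed (S.f.symm^[k + 1] '' X) :=
        (hc.isCompact.image (S.f.symm.continuous.iterate _)).isClosed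
      have e : S.f '' (S.f.symm^[k + 1] '' X) = S.f.symm^[k] '' X := by
        rw [Function.iterate_succ', image_comp, symm_image_image]
      have h1 := S.measure_upper_diff hck (by
        rw [e]; exact antitone_iterate_image hX (Nat.le_succ k))
      rw [e] at h1
      refine measure_mono_null (fun a ha => ?_) (measure_union_null h1 ih)
      by_cases h : a ∈ Upper (S.f.symm^[k] '' X)
      · exact Or.inr ⟨h, ha.2⟩
      · exact Or.inl ⟨ha.1, h⟩
  rw [dense_iff_inter_open]
  intro V hV hne
  by_contra hd
  rw [not_nonempty_iff_eq_empty] at hd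
  refine hne.ne_empty (eq_empty_of_subset_C0 hV fun a ha => ?_)
  by_contra h0
  have ha0 : 0 < (a.2 : ℝ) := a.2.2.1.lt_of_ne fun e => h0 e.symm
  obtain ⟨k, hk⟩ := hs (a.2 / 2) (by linarith)
  have he := eq_empty_of_null volume
    (hV.inter (isOpen_lt continuous_const continuous_height : IsOpen {b : Ann | (a.2 / 2 : ℝ) < b.2}))
    (measure_mono_null (fun b hb => mem_sdiff b |>.2 ⟨mem_upper_of_height hk (le_of_lt hb.2), fun hu =>
      hd.subset ⟨hb.1, hu⟩⟩) (hnull k))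
  exact he.subset ⟨ha, show (a.2 / 2 : ℝ) < a.2 by linarith⟩

theorem exists_unstable : ∃ P, S.Unstable P := by
  obtain ⟨X, hc, hp, h0, hhalf, hsub, hne⟩ := S.exists_continuum
  have h1 : ∀ a ∈ X, a.2 ≠ 1 := fun a ha e => by
    have := hhalf a ha
    rw [e] at this
    norm_num at this
  have hs : ∀ ε : ℝ, 0 < ε → ∃ k : ℕ, ∀ a ∈ S.f.symm^[k] '' X, (a.2 : ℝ) < ε := fun ε hε =>
    S.exists_iterate_subset S.symm_bot (fun K hK => by
      conv_lhs => rw [← hK]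
      exact S.symm_image_image K) hc hp h0 hsub h1 hε
  have hXf : X ⊆ S.f '' X := by
    have := image_mono (f := S.f) hsub
    rwa [symm_image_image] at this
  have hup : ∀ n : ℕ, Upper (S.f^[n] '' X) = S.f^[n] '' Upper X := fun n => by
    induction n with
    | zero => simp
    | succ n ih =>
      rw [Function.iterate_succ', image_comp, image_comp, upper_image, ih]
  have hcl : ∀ n : ℕ, IsClosed (S.f^[n] '' X) := fun n =>
    (hc.isCompact.image (S.f.continuous.iterate n)).isClosed
  refine ⟨fun n => S.f^[n] '' X, hcl, fun n => hp.image _ (S.f.continuous.iterate n).continuousOn,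
    fun n => C0_subset_iterate S.ann_bot h0 n, fun n => ?_, monotone_nat_of_le_succ fun n => ?_,
    ?_, by simpa using hne, ?_, ?_⟩
  · simp only [Function.iterate_succ', image_comp]
  · simp only [Function.iterate_succ, image_comp]
    exact image_mono hXf
  · rintro n _ ⟨a, ha, rfl⟩
    induction n with
    | zero => exact h1 a ha
    | succ n ih =>
      rw [Function.iterate_succ_apply']
      exact fun h => ih ((S.ann_top _).1 h)
  · refine dense_iInter_of_isOpen_nat (fun n => isOpen_upper (hcl n)) fun n => ?_
    rw [hup]
    exact (S.f.surjective.iterate n).denseRange.dense_image (S.f.continuous.iterate n)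
      (S.dense_upper hc hsub hs)
  · rintro n _ ⟨a, ha, rfl⟩
    rw [← tendsto_add_atTop_iff_nat n]
    have e : ∀ k : ℕ, S.f.symm^[k + n] (S.f^[n] a) = S.f.symm^[k] a := fun k => by
      rw [Function.iterate_add_apply, symm_iterate_iterate _ le_rfl, Nat.sub_self]
      rfl
    simp only [e]
    rw [Metric.tendsto_atTop]
    intro ε hε
    obtain ⟨k, hk⟩ := hs ε hε
    refine ⟨k, fun j hj => ?_⟩
    have := hk _ (antitone_iterate_image hsub hj ⟨a, ha, rfl⟩)
    rw [Real.dist_eq, sub_zero, abs_of_nonneg (S.f.symm^[j] a).2.2.1]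
    exact this

end TwistSys

lemma exists_above_of_not_reach {P : Set Ann} {u : StripA} (h : u ∉ ReachFrom 1 Pᶜ) :
    ∃ y, u.2 ≤ y ∧ annProj (u.1, y) ∈ P := by
  by_contra! hno
  refine h (ReachFrom.extend (reachFrom_self (z := (u.1, 1)) (hno 1 u.2.2.2) rfl)
    (segPath _ u) fun s => ?_)
  have h1 : (segPath (u.1, (1 : UI)) u s).1 = u.1 := by rw [segPath_apply_fst]; ring
  have h2 : u.2 ≤ (segPath (u.1, (1 : UI)) u s).2 := by
    rw [← Subtype.coe_le_coe, segPath_apply_snd]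
    have := s.2.1
    have := s.2.2
    have := u.2.2.2
    have e : ((1 : UI) : ℝ) = 1 := rfl
    simp only [e]
    nlinarith
  have := hno _ h2
  rwa [← h1] at this

namespace TwistSys

variable {S : TwistSys} {P : ℕ → Set Ann} {z w : StripA}

/-- The points whose angle with some point of one of the sets `P n` has wound below the downward
vertical. -/
def Shadow (S : TwistSys) (P : ℕ → Set Ann) : Set Ann :=
  ⋃ n, annProj '' S.Sees (Iio (-(Real.pi / 2))) (P n)

lemma Unstable.isOpen_shadow (hP : S.Unstable P) : IsOpen (S.Shadow P) :=
  isOpen_iUnion fun n => isOpenMap_annProj _ (isOpen_sees (hP.closed n) isOpen_Iio)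

lemma Ang.sees_image {P : Set Ann} {θ : ℝ} (hw : annProj w ∈ P) (h : S.Ang P z w θ)
    (hθ : θ ≤ -(Real.pi / 2)) : S.F z ∈ S.Sees (Iio (-(Real.pi / 2))) (S.f '' P) := by
  have hne := ne_of_proj (ReachFrom.proj_mem h.reach) hw
  obtain ⟨θ', h', hs⟩ := h.step hw
  exact ⟨S.F w, (S.proj_image P w).2 hw, θ', ang_step_low h.isAng h'.isAng (S.disp_ne_zero hne)
    (S.disp_ne_zero fun e => hne (S.F.injective e)) hs hθ, h'⟩

lemma Unstable.image_shadow_subset (hP : S.Unstable P) : S.f '' S.Shadow P ⊆ S.Shadow P := by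
  rintro _ ⟨a, ha, rfl⟩
  obtain ⟨n, z, ⟨w, hw, θ, hθ, h⟩, rfl⟩ := mem_iUnion.1 ha
  refine mem_iUnion.2 ⟨n + 1, S.F z, ?_, S.proj z⟩
  rw [hP.succ]
  exact h.sees_image hw (le_of_lt hθ)

lemma Unstable.exists_above (hP : S.Unstable P) {n : ℕ}
    (hz : z ∈ S.Sees (Iio (-(Real.pi / 2))) (P n)) :
    ∃ y, z.2 < y ∧ annProj (z.1, y) ∈ P n := by
  by_contra! hno
  obtain ⟨w, hw, θ, hθ, h⟩ := hz
  obtain ⟨θ', hθ', h'⟩ := exists_ang_of_vertical (S := S) (z := z) (fun y hy => by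
    rcases hy.eq_or_lt with rfl | hy
    · exact ReachFrom.proj_mem h.reach
    · exact hno y hy) hw
  rw [h.unique (hP.preconnected n) (hP.bot_subset n) hw h'] at hθ
  exact lt_asymm hθ hθ'.1

lemma Unstable.lt_of_ang (hP : S.Unstable P) {n : ℕ} {θ : ℝ} (hw : annProj w ∈ P (n + 1))
    (h : S.Ang (P (n + 1)) z w θ) : θ < 3 * Real.pi / 2 := by
  rw [hP.succ] at hw h
  exact h.lt_of_expanding (hP.closed n) (hP.preconnected n) (hP.bot_subset n)
    (by rw [← hP.succ]; exact hP.mono n.le_succ) hw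

lemma Unstable.le_of_ang (hP : S.Unstable P) {n : ℕ} {θ : ℝ} {x : ℝ} {a b : UI} (hab : a < b)
    (hw : annProj (x, b) ∈ P (n + 1)) (h : S.Ang (P (n + 1)) (x, a) (x, b) θ) :
    θ ≤ -(Real.pi / 2) := by
  have hd := S.disp_of_down x hab
  exact h.isAng.le_of_down hd.1 hd.2 (hP.lt_of_ang hw h)

lemma Unstable.mem_shadow_of_below (hP : S.Unstable P) {n : ℕ} {x : ℝ} {a b : UI} (hab : a < b)
    (hz : (x, a) ∈ ReachFrom 1 (P (n + 1))ᶜ) (hw : annProj (x, b) ∈ P (n + 1)) :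
    S.f (annProj (x, a)) ∈ S.Shadow P := by
  obtain ⟨θ, h⟩ := exists_ang (S := S) hz hw
  refine mem_iUnion.2 ⟨n + 2, S.F (x, a), ?_, S.proj _⟩
  rw [hP.succ]
  exact h.sees_image hw (hP.le_of_ang hab hw h)

lemma Unstable.image_closure_shadow (hP : S.Unstable P) :
    S.f '' closure (S.Shadow P) = closure (S.Shadow P) := by
  rw [S.f.image_closure]
  refine subset_antisymm (closure_mono hP.image_shadow_subset)
    (closure_minimal (fun a ha => ?_) isClosed_closure)
  by_contra hc
  have hfo : IsOpen (S.f '' S.Shadow P) := S.f.isOpenMap _ hP.isOpen_shadow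
  have h0 : volume (S.Shadow P \ S.f '' S.Shadow P) = 0 := by
    rw [measure_sdiff hP.image_shadow_subset hfo.measurableSet.nullMeasurableSet
      (measure_ne_top _ _), measure_image, tsub_self]
  have he := eq_empty_of_null volume
    (hP.isOpen_shadow.inter (isClosed_closure (s := S.f '' S.Shadow P)).isOpen_compl)
    (measure_mono_null (fun b hb => (mem_sdiff b).2 ⟨hb.1, fun h => hb.2 (subset_closure h)⟩) h0)
  exact he.subset ⟨ha, hc⟩

lemma Unstable.mem_closure_shadow_iff (hP : S.Unstable P) (a : Ann) :
    S.f a ∈ closure (S.Shadow P) ↔ a ∈ closure (S.Shadow P) := by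
  conv_lhs => rw [← hP.image_closure_shadow]
  exact S.f.injective.mem_set_image

lemma Unstable.exists_dense (hP : S.Unstable P) {N : Set StripA} (hN : IsOpen N)
    (hne : N.Nonempty) : ∃ z ∈ N, ∀ n, z ∈ ReachFrom 1 (P n)ᶜ := by
  obtain ⟨_, ⟨z, hz, rfl⟩, hU⟩ :=
    hP.dense.inter_open_nonempty _ (isOpenMap_annProj N hN) (hne.image _)
  exact ⟨z, hz, fun n => annProj_mem_upper.1 (mem_iInter.1 hU n)⟩

lemma Unstable.mem_closure_of_shadow (hP : S.Unstable P) {x : 𝕋} {u v : UI} (huv : u ≤ v)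
    (hv : (x, v) ∈ S.Shadow P) : (x, u) ∈ closure (S.Shadow P) := by
  rcases huv.eq_or_lt with rfl | huv
  · exact subset_closure hv
  obtain ⟨n, ⟨x, v⟩, hz, e⟩ := mem_iUnion.1 hv
  obtain ⟨rfl, rfl⟩ := Prod.ext_iff.1 e
  show annProj (x, u) ∈ _
  rw [← closure_closure, mem_closure_iff]
  intro V hV hVm
  obtain ⟨⟨x', u'⟩, ⟨⟨h1, h2⟩, h3⟩, hr⟩ := hP.exists_dense (N := annProj ⁻¹' V ∩
    (fun z : StripA => (z.1, v)) ⁻¹' S.Sees (Iio (-(Real.pi / 2))) (P n) ∩ {z | z.2 < v})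
    (((hV.preimage continuous_annProj).inter
      ((isOpen_sees (hP.closed n) isOpen_Iio).preimage (by fun_prop))).inter
      (isOpen_lt continuous_snd continuous_const)) ⟨(x, u), ⟨hVm, hz⟩, huv⟩
  obtain ⟨y, hy, hyP⟩ := hP.exists_above h2
  refine ⟨annProj (x', u'), h1, ?_⟩
  rw [← hP.mem_closure_shadow_iff]
  exact subset_closure (hP.mem_shadow_of_below (lt_trans h3 hy) (hr (n + 1))
    (hP.mono n.le_succ hyP))

lemma Unstable.mem_closure_of_le (hP : S.Unstable P) {x : 𝕋} {u v : UI} (huv : u ≤ v)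
    (hv : (x, v) ∈ closure (S.Shadow P)) : (x, u) ∈ closure (S.Shadow P) := by
  have hc : Continuous fun a : Ann => ((a.1, min a.2 u) : Ann) := by fun_prop
  have := map_mem_closure hc hv (t := closure (S.Shadow P)) fun a ha =>
    hP.mem_closure_of_shadow (min_le_left a.2 u) ha
  rw [closure_closure] at this
  simpa only [min_eq_right huv] using this

lemma Unstable.shadow_nonempty (hP : S.Unstable P) : (S.Shadow P).Nonempty := by
  obtain ⟨a, ha, ha0⟩ := hP.nontrivial
  obtain ⟨⟨x, v⟩, rfl⟩ := annProj_surjective a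
  have hv0 : 0 < (v : ℝ) := v.2.1.lt_of_ne fun e => ha0 (Subtype.ext e.symm)
  have hw1 : annProj (x, v) ∈ P 1 := hP.mono zero_le_one ha
  by_cases hex : ∃ y < v, (x, y) ∈ ReachFrom 1 (P 1)ᶜ
  · obtain ⟨y, hy, hr⟩ := hex
    exact ⟨_, hP.mem_shadow_of_below (n := 0) hy hr hw1⟩
  push Not at hex
  have hno : ∀ y ≤ v, (x, y) ∉ ReachFrom 1 (P 1)ᶜ := fun y hy => by
    rcases hy.eq_or_lt with rfl | hy
    · exact fun h => ReachFrom.proj_mem h hw1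
    · exact hex y hy
  set m : UI := ⟨v / 2, by linarith, by linarith [v.2.2]⟩
  have hmv : m < v := by
    show (v / 2 : ℝ) < v
    linarith
  have hm0 : 0 < m := by
    show (0 : ℝ) < v / 2
    linarith
  set g : UI → StripA := fun y => S.F.symm (x, y)
  have hg : Continuous g := S.F.symm.continuous.comp (Continuous.prodMk_right x)
  obtain ⟨y₀, hy₀, hmin⟩ := (isCompact_Icc (a := m) (b := v)).exists_isMinOn
    (nonempty_Icc.2 hmv.le) (f := fun y => (g y).2) (continuous_snd.comp hg).continuousOn
  have hc0 : 0 < (g y₀).2 := by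
    refine lt_of_le_of_ne (g y₀).2.2.1 fun e => ?_
    have h1 : y₀ = 0 := (S.bot_symm (x, y₀)).1 e.symm
    exact absurd (h1 ▸ hy₀.1) (not_le.2 hm0)
  obtain ⟨⟨x', u⟩, ⟨⟨h1, h2⟩, h3⟩, hr⟩ := hP.exists_dense
    (N := {z | (g v).1 < z.1} ∩ {z | z.1 < (g m).1} ∩ {z | z.2 < (g y₀).2})
    (((isOpen_lt continuous_const continuous_fst).inter
      (isOpen_lt continuous_fst continuous_const)).inter
      (isOpen_lt continuous_snd continuous_const))
    (by
      obtain ⟨t, ht⟩ := exists_between (S.twist_symm x m v hmv)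
      exact ⟨(t, 0), ⟨ht.1, ht.2⟩, hc0⟩)
  obtain ⟨y, hy, hyx⟩ := (isPreconnected_Icc (a := m) (b := v)).intermediate_value
    (right_mem_Icc.2 hmv.le) (left_mem_Icc.2 hmv.le)
    (continuous_fst.comp hg).continuousOn ⟨le_of_lt h1, le_of_lt h2⟩
  have hyr : g y ∉ ReachFrom 1 (P 0)ᶜ := by
    rw [← S.mem_reach_image, S.F.apply_symm_apply, ← hP.succ]
    exact hno y hy.2
  obtain ⟨y', hy', hyP⟩ := exists_above_of_not_reach hyr
  have e : (g y).1 = x' := hyx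
  rw [e] at hyP
  have hlt : u < y' := (lt_of_lt_of_le h3 (hmin hy)).trans_le hy'
  exact ⟨_, hP.mem_shadow_of_below (n := 0) hlt (hr 1) (hP.mono zero_le_one hyP)⟩

/-- The shadow of an unstable continuum is dense. -/
lemma Unstable.mem_closure_shadow (hP : S.Unstable P) {a : Ann} (ha : a.2 ≠ 1) :
    a ∈ closure (S.Shadow P) := by
  refine interior_subset (S.mem_of_lower (D := interior (closure (S.Shadow P))) isOpen_interior
    (fun a => ?_) (fun x u v huv hv => ?_) ?_ ha)
  · conv_lhs => rw [← hP.image_closure_shadow, ← S.f.image_interior]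
    exact S.f.injective.mem_set_image
  · rcases huv.eq_or_lt with rfl | huv
    · exact hv
    obtain ⟨A, B, hA, -, hxA, hvB, hAB⟩ := isOpen_prod_iff.1 isOpen_interior x v hv
    refine mem_interior.2 ⟨A ×ˢ Iio v, ?_, hA.prod isOpen_Iio, hxA, huv⟩
    rintro ⟨x', u'⟩ ⟨hx', hu'⟩
    exact hP.mem_closure_of_le (le_of_lt hu') (interior_subset (hAB ⟨hx', hvB⟩))
  · exact hP.shadow_nonempty.mono (interior_maximal subset_closure hP.isOpen_shadow)

end TwistSys

namespace TwistSys

variable {S : TwistSys} {P Q : ℕ → Set Ann}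

lemma annFlipY_flipY (a : Ann) : annFlipY (annFlipY a) = a := by simp

/-- A point of a stable continuum strictly below a point of an unstable continuum forces the two
continua to meet. -/
lemma inter_nonempty_of_below (hP : S.Unstable P) (hQ : S.dual.Unstable Q) {n m : ℕ} {x : ℝ}
    {a b : UI} (hab : a < b) (hb : annProj (x, b) ∈ P (n + 1))
    (ha : annFlipY (annProj (x, a)) ∈ Q (m + 2)) : (P (n + 1) ∩ annFlipY ⁻¹' Q (m + 2)).Nonempty := by
  by_contra hemp
  rw [not_nonempty_iff_eq_empty] at hemp
  have hQc : IsClosed (annFlipY ⁻¹' Q (m + 2)) := (hQ.closed _).preimage annFlipY.continuous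
  obtain ⟨U, V, hU, hV, hPU, hQV, hd⟩ := SeparatedNhds.of_isCompact_isCompact
    (hP.closed (n + 1)).isCompact hQc.isCompact (disjoint_iff_inter_eq_empty.2 hemp)
  rw [Set.disjoint_left] at hd
  obtain ⟨p, hp, δ, hδ⟩ := exists_path_avoiding (hP.preconnected _) (hP.bot_subset _) hb
    hU.isClosed_compl (fun a ha h => h (hPU ha))
  obtain ⟨t, ht, γ, hγ⟩ := mem_reachFrom_of_isPreconnected (c := 1)
    (annFlipY.isPreconnected_preimage.2 (hQ.preconnected (m + 2))) hV hQV
    (fun a ha => hQ.bot_subset _ (mem_C0.2 (by simp [ha]))) (z := (x, a)) ha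
  have hδU : ∀ s, annProj (δ s) ∈ U := fun s => not_not.1 (hδ s)
  have hne : ∀ s s', γ s ≠ δ s' := fun s s' e => hd (hδU s') (by rw [← e]; exact hγ s)
  obtain ⟨L, hL, hL0⟩ := S.exists_lift_disp γ (Path.refl (x, b))
    (fun s => by simpa using hne s 1) (Or.inl ht)
  obtain ⟨M, hM, hM0⟩ := S.exists_lift_disp (Path.refl (x, a)) δ
    (fun s => by simpa using hne 1 s) (Or.inr hp)
  have e := angle_square γ δ ht hp hne L.continuous M.continuous hL hM hL0 hM0
  have h1 : S.Ang (P (n + 1)) (x, a) (x, b) (L 1) :=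
    ⟨t, ht, γ, L, fun s h => hd (hPU h) (hγ s), hL, hL0, rfl⟩
  have h2 : S.dual.Ang (Q (m + 1)) (stripFlipY (S.F (x, b))) (stripFlipY (S.F (x, a)))
      (3 * Real.pi / 2 - M 1) := by
    have hd' : ∀ u v, S.dual.disp (stripFlipY (S.F u)) (stripFlipY (S.F v)) =
        ⟨-(S.disp v u).im, -(S.disp v u).re⟩ := fun u v => by
      have i2 : ∀ z : StripA, stripFlipY (stripFlipY z) = z := fun z => by simp
      apply Complex.ext <;> simp only [disp, dual_F, i2, S.F.symm_apply_apply] <;> simp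
    refine ⟨stripFlipY (S.F p), ?_, δ.map (stripFlipY.continuous.comp S.F.continuous),
      ⟨fun s => 3 * Real.pi / 2 - M s, by fun_prop⟩, fun s => ?_, fun s => ?_, ?_, rfl⟩
    · simp [(S.bot p).2 hp]
    · show annProj (stripFlipY (S.F (δ s))) ∉ _
      intro h
      rw [← S.dual.f.injective.mem_set_image, ← hQ.succ, annProj_flipY, dual_f, annFlipY_flipY,
        S.proj, S.f.symm_apply_apply] at h
      exact hd (hδU s) (hQV h)
    · show IsAng (S.dual.disp (stripFlipY (S.F (δ s))) _) _
      rw [hd']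
      exact (hM s).neg_swap
    · simp only [ContinuousMap.coe_mk]
      exact ⟨by linarith [hM0.2], by linarith [hM0.1]⟩
  have h3 := hP.le_of_ang hab hb h1
  have h4 := hQ.lt_of_ang (by
    rw [← S.dual.f.injective.mem_set_image, ← hQ.succ, annProj_flipY, dual_f, annFlipY_flipY,
        S.proj, S.f.symm_apply_apply]
    exact ha) h2
  linarith [Real.pi_pos]

/-- There is an orbit going from the bottom circle to the top circle. -/
theorem exists_connecting_orbit (S : TwistSys) : ∃ a : Ann, a.2 ≠ 0 ∧ a.2 ≠ 1 ∧
    Tendsto (fun k : ℕ => ((S.f.symm^[k] a).2 : ℝ)) atTop (𝓝 0) ∧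
    Tendsto (fun k : ℕ => ((S.f^[k] a).2 : ℝ)) atTop (𝓝 1) := by
  obtain ⟨P, hP⟩ := S.exists_unstable
  obtain ⟨Q, hQ⟩ := S.dual.exists_unstable
  obtain ⟨c, hcP, hc0⟩ : (S.Shadow P ∩ {a : Ann | a.2 ≠ 0}).Nonempty := by
    have hm := hP.mem_closure_shadow (a := ((0 : 𝕋), ⟨1 / 2, by norm_num, by norm_num⟩))
      (fun h => by simpa using congrArg Subtype.val h)
    obtain ⟨c, h1, h2⟩ := mem_closure_iff.1 hm {a : Ann | a.2 ≠ 0}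
      (isOpen_ne_fun continuous_snd continuous_const)
      (fun h => by simpa using congrArg Subtype.val h)
    exact ⟨c, h2, h1⟩
  have hm := hQ.mem_closure_shadow (a := annFlipY c) (by simpa using hc0)
  obtain ⟨d, hd, hdQ⟩ := mem_closure_iff.1 hm (annFlipY ⁻¹' S.Shadow P)
    (hP.isOpen_shadow.preimage annFlipY.continuous) (by rwa [mem_preimage, annFlipY_flipY])
  obtain ⟨n, z, hz, e⟩ := mem_iUnion.1 (mem_preimage.1 hd)
  obtain ⟨m, z', hz', e'⟩ := mem_iUnion.1 hdQ
  have hz2 : stripFlipY z ∈ S.dual.Sees (Iio (-(Real.pi / 2))) (Q m) :=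
    Sees.of_proj_eq hz' (by rw [e', annProj_flipY, e, annFlipY_flipY])
  obtain ⟨b, hb, hbP⟩ := hP.exists_above hz
  obtain ⟨a, ha, haQ⟩ := hQ.exists_above hz2
  have hab : unitInterval.symm a < b := by
    refine lt_trans ?_ hb
    have := unitInterval.strictAnti_symm ha
    simpa using this
  obtain ⟨p, hpP, hpQ⟩ := inter_nonempty_of_below hP hQ (n := n) (m := m) (x := z.1) hab
    (hP.mono n.le_succ hbP) (hQ.mono (Nat.le_add_right m 2) (by simpa [annProj] using haQ))
  refine ⟨p, fun h => hQ.ne_top _ _ hpQ (by simp [h]), hP.ne_top _ _ hpP, hP.tendsto _ _ hpP, ?_⟩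
  have hit : ∀ k : ℕ, S.dual.f.symm^[k] (annFlipY p) = annFlipY (S.f^[k] p) := fun k => by
    induction k with
    | zero => rfl
    | succ k ih =>
      rw [Function.iterate_succ_apply', ih, dual_f_symm, annFlipY_flipY,
        Function.iterate_succ_apply']
  have ht := hQ.tendsto _ _ hpQ
  simp only [hit] at ht
  have := ht.const_sub 1
  simpa using this

end TwistSys

lemma convex_stripS : Convex ℝ stripS := by
  have : stripS = Prod.snd ⁻¹' Icc (0 : ℝ) 1 := rfl
  rw [this]
  exact (convex_Icc 0 1).linear_preimage (LinearMap.snd ℝ ℝ ℝ)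

lemma stripS_mem_nhds {p : ℝ × ℝ} (hp : p.2 ∈ Ioo (0 : ℝ) 1) : stripS ∈ 𝓝 p :=
  continuous_snd.continuousAt.preimage_mem_nhds (Icc_mem_nhds hp.1 hp.2)

lemma uniqueDiffOn_stripS : UniqueDiffOn ℝ stripS :=
  uniqueDiffOn_convex convex_stripS
    ⟨(0, 1 / 2), mem_interior_iff_mem_nhds.2 (stripS_mem_nhds (by norm_num))⟩

/-- A differentiable map of the strip with a differentiable left inverse maps no point of the top
line to an interior point. -/
lemma not_mem_Ioo_of_top {A B : ℝ × ℝ → ℝ × ℝ} {A' B' : (ℝ × ℝ) →L[ℝ] (ℝ × ℝ)} {p : ℝ × ℝ}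
    (hp : p.2 = 1) (hA : HasFDerivWithinAt A A' stripS p)
    (hB : HasFDerivWithinAt B B' stripS (A p)) (hAm : MapsTo A stripS stripS)
    (hBm : MapsTo B stripS stripS) (hBA : ∀ q ∈ stripS, B (A q) = q) :
    (A p).2 ∉ Ioo (0 : ℝ) 1 := by
  intro hint
  have hps : p ∈ stripS := by
    show p.2 ∈ Icc (0 : ℝ) 1
    rw [hp]; norm_num
  have hcomp : HasFDerivWithinAt id (B'.comp A') stripS p :=
    (hB.comp p hA hAm).congr (fun q hq => (hBA q hq).symm) (hBA p hps).symm
  have hid : B'.comp A' = ContinuousLinearMap.id ℝ (ℝ × ℝ) :=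
    (uniqueDiffOn_stripS p hps).eq hcomp (hasFDerivWithinAt_id p stripS)
  have hB2 : HasFDerivAt (fun q => (B q).2) ((ContinuousLinearMap.snd ℝ ℝ ℝ).comp B') (A p) :=
    (hB.hasFDerivAt (stripS_mem_nhds hint)).snd
  have hmax : IsLocalMax (fun q => (B q).2) (A p) := by
    filter_upwards [stripS_mem_nhds hint] with q hq
    rw [hBA p hps, hp]
    exact (hBm hq).2
  have h0 := hmax.hasFDerivAt_eq_zero hB2
  have h1 := congrArg (fun T : (ℝ × ℝ) →L[ℝ] ℝ => T (A' (0, 1))) h0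
  have h2 := congrArg (fun T : (ℝ × ℝ) →L[ℝ] (ℝ × ℝ) => (T (0, 1)).2) hid
  simp at h1 h2
  linarith

lemma strictMono_of_translation {φ : ℝ → ℝ} (hc : Continuous φ) (hi : Function.Injective φ)
    (h1 : ∀ x, φ (x + 1) = φ x + 1) : StrictMono φ := by
  rcases hc.strictMono_of_inj hi with h | h
  · exact h
  · have := h (show (0 : ℝ) < 0 + 1 by norm_num)
    rw [h1] at this
    linarith

lemma surjective_of_translation {φ : ℝ → ℝ} (hc : Continuous φ)
    (h1 : ∀ x, φ (x + 1) = φ x + 1) : Function.Surjective φ := by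
  have hn : ∀ n : ℕ, φ n = φ 0 + n := fun n => by
    induction n with
    | zero => simp
    | succ n ih => rw [Nat.cast_succ, h1, ih]; ring
  have hm : ∀ n : ℕ, φ (-n) = φ 0 - n := fun n => by
    induction n with
    | zero => simp
    | succ n ih =>
      have := h1 (-((n + 1 : ℕ) : ℝ))
      rw [show -((n + 1 : ℕ) : ℝ) + 1 = -(n : ℝ) by push_cast; ring, ih] at this
      push_cast at this ⊢
      linarith
  intro y
  obtain ⟨n, hy⟩ := exists_nat_ge |y - φ 0|
  have h := abs_le.1 hy
  have hle : (-(n : ℝ)) ≤ n := by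
    have : (0 : ℝ) ≤ n := n.cast_nonneg
    linarith
  obtain ⟨x, -, hx⟩ := intermediate_value_Icc hle hc.continuousOn
    (show y ∈ Icc (φ (-n)) (φ n) by rw [hn, hm]; constructor <;> linarith)
  exact ⟨x, hx⟩

namespace PositiveTwistMap

variable (f : PositiveTwistMap)

lemma lift_deckT_fst (x : ℝ) (c : UI) : (f.lift (x + 1, c)).1 = (f.lift (x, c)).1 + 1 :=
  congrArg Prod.fst (f.lift_deck (x, c))

lemma continuous_lift_fst (c : UI) : Continuous fun x => (f.lift (x, c)).1 :=
  continuous_fst.comp (f.lift.continuous.comp (Continuous.prodMk_left c))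

lemma lift_bot (z : StripA) : (f.lift z).2 = 0 ↔ z.2 = 0 := by
  refine ⟨fun h => ?_, fun h => Subtype.ext (f.lift_bd0 z (congrArg Subtype.val h))⟩
  obtain ⟨x, hx⟩ := surjective_of_translation (f.continuous_lift_fst 0)
    (fun x => f.lift_deckT_fst x 0) (f.lift z).1
  have h2 : (f.lift (x, 0)).2 = 0 := Subtype.ext (f.lift_bd0 _ rfl)
  have e : f.lift (x, 0) = f.lift z := Prod.ext hx (h2.trans h.symm)
  rw [← f.lift.injective e]

lemma mapsTo_F : MapsTo f.F stripS stripS := fun q hq => by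
  have := f.F_lift (q.1, ⟨q.2, hq⟩)
  rw [show f.F q = _ from this]
  exact (f.lift _).2.2

lemma mapsTo_G : MapsTo f.G stripS stripS := fun q hq => by
  have := f.G_lift (q.1, ⟨q.2, hq⟩)
  rw [show f.G q = _ from this]
  exact (f.lift.symm _).2.2

lemma G_F (q : ℝ × ℝ) (hq : q ∈ stripS) : f.G (f.F q) = q := by
  have h1 := f.F_lift (q.1, ⟨q.2, hq⟩)
  rw [show f.F q = _ from h1, f.G_lift (f.lift (q.1, ⟨q.2, hq⟩)), f.lift.symm_apply_apply]

lemma F_G (q : ℝ × ℝ) (hq : q ∈ stripS) : f.F (f.G q) = q := by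
  have h1 := f.G_lift (q.1, ⟨q.2, hq⟩)
  rw [show f.G q = _ from h1, f.F_lift (f.lift.symm (q.1, ⟨q.2, hq⟩)), f.lift.apply_symm_apply]

lemma lift_top (z : StripA) : (f.lift z).2 = 1 ↔ z.2 = 1 := by
  have hs : ∀ z : StripA, (z.1, (z.2 : ℝ)) ∈ stripS := fun z => z.2.2
  constructor <;> intro h
  · by_contra hz
    have h0 : z.2 ≠ 0 := fun h0 => by
      rw [(f.lift_bot z).2 h0] at h
      exact zero_ne_one h
    have e : f.G ((f.lift z).1, ((f.lift z).2 : ℝ)) = (z.1, (z.2 : ℝ)) := by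
      rw [f.G_lift, f.lift.symm_apply_apply]
    refine not_mem_Ioo_of_top (p := ((f.lift z).1, ((f.lift z).2 : ℝ)))
      (congrArg Subtype.val h) (f.G_hasDeriv _ (hs _)) (f.F_hasDeriv _ (f.mapsTo_G (hs _)))
      f.mapsTo_G f.mapsTo_F f.F_G ?_
    rw [e]
    exact ⟨z.2.2.1.lt_of_ne fun e => h0 (Subtype.ext e.symm),
      z.2.2.2.lt_of_ne fun e => hz (Subtype.ext e)⟩
  · by_contra hz
    have h0 : (f.lift z).2 ≠ 0 := fun h0 => by
      rw [(f.lift_bot z).1 h0] at h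
      exact zero_ne_one h
    refine not_mem_Ioo_of_top (p := (z.1, (z.2 : ℝ)))
      (congrArg Subtype.val h) (f.F_hasDeriv _ (hs _)) (f.G_hasDeriv _ (f.mapsTo_F (hs _)))
      f.mapsTo_F f.mapsTo_G f.G_F ?_
    rw [f.F_lift]
    exact ⟨(f.lift z).2.2.1.lt_of_ne fun e => h0 (Subtype.ext e.symm),
      (f.lift z).2.2.2.lt_of_ne fun e => hz (Subtype.ext e)⟩

lemma lift_strictMono_fst {c : UI} (hc : ∀ x, (f.lift (x, c)).2 = c) :
    StrictMono fun x => (f.lift (x, c)).1 :=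
  strictMono_of_translation (f.continuous_lift_fst c)
    (fun x x' h => congrArg Prod.fst (f.lift.injective
      (show f.lift (x, c) = f.lift (x', c) from Prod.ext h ((hc x).trans (hc x').symm))))
    fun x => f.lift_deckT_fst x c

lemma lift_twist (x : ℝ) (a b : UI) (hab : a < b) : (f.lift (x, a)).1 < (f.lift (x, b)).1 := by
  have hd : ∀ y ∈ Icc (0 : ℝ) 1, HasDerivWithinAt (fun y => (f.F (x, y)).1)
      (f.F' (x, y) (0, 1)).1 (Icc 0 1) y := fun y hy => by
    have h1 : HasDerivWithinAt (fun y : ℝ => (x, y)) ((0 : ℝ), (1 : ℝ)) (Icc 0 1) y :=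
      (hasDerivWithinAt_const y _ x).prodMk (hasDerivWithinAt_id y _)
    have h2 := (f.F_hasDeriv (x, y) hy).comp_hasDerivWithinAt y h1 (fun y' hy' => hy')
    exact hasFDerivAt_fst.comp_hasDerivWithinAt y h2
  have hm := strictMonoOn_of_hasDerivWithinAt_pos (convex_Icc (0 : ℝ) 1)
    (fun y hy => (hd y hy).continuousWithinAt)
    (fun y hy => (hd y (interior_subset hy)).mono interior_subset)
    (fun y hy => f.twist_pos (x, y) (show y ∈ Icc (0 : ℝ) 1 from interior_subset hy))
  have h := hm a.2 b.2 hab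
  have ea := congrArg Prod.fst (f.F_lift (x, a))
  have eb := congrArg Prod.fst (f.F_lift (x, b))
  simp only at ea eb h
  rwa [ea, eb] at h

lemma lift_symm_twist (x : ℝ) (a b : UI) (hab : a < b) :
    (f.lift.symm (x, b)).1 < (f.lift.symm (x, a)).1 := by
  have hc : Continuous fun y : UI => (f.lift.symm (x, y)).1 :=
    continuous_fst.comp (f.lift.symm.continuous.comp (Continuous.prodMk_right x))
  have ht : ∀ u u' : StripA, u.1 = u'.1 → (f.lift u).1 = (f.lift u').1 → u = u' := by
    rintro ⟨p, q⟩ ⟨p', q'⟩ h h'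
    obtain rfl : p = p' := h
    rcases lt_trichotomy q q' with hq | rfl | hq
    · exact absurd h' (f.lift_twist p _ _ hq).ne
    · rfl
    · exact absurd h' (f.lift_twist p _ _ hq).ne'
  have hi : Function.Injective fun y : UI => (f.lift.symm (x, y)).1 := fun y y' h => by
    have := ht _ _ h (by simp)
    exact congrArg Prod.snd (f.lift.symm.injective this)
  rcases hc.strictMono_of_inj_boundedOrder' hi with h | h
  · exfalso
    have h01 : (f.lift.symm (x, 0)).1 < (f.lift.symm (x, 1)).1 := h zero_lt_one
    have e0 : ((f.lift.symm (x, 0)).1, (0 : UI)) = f.lift.symm (x, 0) :=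
      Prod.ext rfl ((f.lift_bot _).1 (by simp)).symm
    have e1 : ((f.lift.symm (x, 1)).1, (1 : UI)) = f.lift.symm (x, 1) :=
      Prod.ext rfl ((f.lift_top _).1 (by simp)).symm
    have h1 := f.lift_strictMono_fst (c := 1) (fun x => (f.lift_top (x, 1)).2 rfl) h01
    have h2 := f.lift_twist (f.lift.symm (x, 0)).1 0 1 zero_lt_one
    simp only at h1
    rw [e1, f.lift.apply_symm_apply] at h1
    rw [e0, f.lift.apply_symm_apply] at h2
    exact lt_asymm h1 h2
  · exact h hab

/-- The twist system attached to an area-preserving positive twist map. -/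
def toTwistSys (hArea : MeasurePreserving f.toFun volume volume)
    (hNoGraph : ∀ ψ : 𝕋 → ℝ, Continuous ψ → (∀ x : 𝕋, ψ x ∈ Set.Icc (0:ℝ) 1) →
      f.toFun '' {z : Ann | (z.2 : ℝ) = ψ z.1} = {z : Ann | (z.2 : ℝ) = ψ z.1} →
      {z : Ann | (z.2 : ℝ) = ψ z.1} = C0 ∨ {z : Ann | (z.2 : ℝ) = ψ z.1} = C1) : TwistSys where
  f := f.toFun
  F := f.lift
  proj := f.lift_proj
  deck := f.lift_deck
  bot := f.lift_bot
  top := f.lift_top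
  mono_bot _ _ h := f.lift_strictMono_fst (fun x => (f.lift_bot (x, 0)).2 rfl) h
  mono_top _ _ h := f.lift_strictMono_fst (fun x => (f.lift_top (x, 1)).2 rfl) h
  twist := f.lift_twist
  twist_symm := f.lift_symm_twist
  area := hArea
  noGraph := hNoGraph

end PositiveTwistMap

lemma infDist_C0_le (a : Ann) : Metric.infDist a C0 ≤ a.2 := by
  refine (Metric.infDist_le_dist_of_mem (y := (a.1, 0)) (mem_C0.2 rfl)).trans ?_
  rw [Prod.dist_eq, dist_self, Subtype.dist_eq, Real.dist_eq]
  simp [abs_of_nonneg a.2.2.1, a.2.2.1]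

lemma infDist_C1_le (a : Ann) : Metric.infDist a C1 ≤ 1 - a.2 := by
  refine (Metric.infDist_le_dist_of_mem (y := (a.1, 1)) (mem_C1.2 rfl)).trans ?_
  rw [Prod.dist_eq, dist_self, Subtype.dist_eq, Real.dist_eq, abs_sub_comm]
  have e : ((1 : UI) : ℝ) = 1 := rfl
  simp [abs_of_nonneg (sub_nonneg.2 a.2.2.2), a.2.2.2]

lemma AnnulusHomeo.tendsto_iter_atTop (h : AnnulusHomeo) {g : Ann → ℝ} {l : Filter ℝ} {a : Ann}
    (ht : Tendsto (fun k : ℕ => g (h.toFun^[k] a)) atTop l) :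
    Tendsto (fun k : ℤ => g (h.iter k a)) atTop l := by
  rw [← Nat.map_cast_int_atTop, tendsto_map'_iff]
  convert ht using 2 with k
  simp only [Function.comp_apply, AnnulusHomeo.iter, zpow_natCast, ← Equiv.Perm.iterate_eq_pow]
  rfl

lemma AnnulusHomeo.tendsto_iter_atBot (h : AnnulusHomeo) {g : Ann → ℝ} {l : Filter ℝ} {a : Ann}
    (ht : Tendsto (fun k : ℕ => g (h.toFun.symm^[k] a)) atTop l) :
    Tendsto (fun k : ℤ => g (h.iter k a)) atBot l := by
  rw [← Filter.map_neg_atTop, tendsto_map'_iff, ← Nat.map_cast_int_atTop, tendsto_map'_iff]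
  convert ht using 2 with k
  simp only [Function.comp_apply, AnnulusHomeo.iter, zpow_neg, zpow_natCast, ← inv_pow,
    ← Equiv.Perm.iterate_eq_pow]
  rfl

lemma tendsto_infDist_C0 {ι : Type*} {l : Filter ι} {u : ι → Ann}
    (h : Tendsto (fun k => ((u k).2 : ℝ)) l (𝓝 0)) :
    Tendsto (fun k => Metric.infDist (u k) C0) l (𝓝 0) :=
  squeeze_zero (fun _ => Metric.infDist_nonneg) (fun k => infDist_C0_le (u k)) h

lemma tendsto_infDist_C1 {ι : Type*} {l : Filter ι} {u : ι → Ann}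
    (h : Tendsto (fun k => ((u k).2 : ℝ)) l (𝓝 1)) :
    Tendsto (fun k => Metric.infDist (u k) C1) l (𝓝 0) :=
  squeeze_zero (fun _ => Metric.infDist_nonneg) (fun k => infDist_C1_le (u k))
    (by simpa using h.const_sub 1)

/-- There is an orbit going from the top circle to the bottom circle. -/
theorem TwistSys.exists_connecting_orbit_down (S : TwistSys) : ∃ a : Ann, a.2 ≠ 0 ∧ a.2 ≠ 1 ∧
    Tendsto (fun k : ℕ => ((S.f.symm^[k] a).2 : ℝ)) atTop (𝓝 1) ∧
    Tendsto (fun k : ℕ => ((S.f^[k] a).2 : ℝ)) atTop (𝓝 0) := by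
  obtain ⟨a, h0, h1, hb, ht⟩ := S.refl.dual.exists_connecting_orbit
  set ρ : Ann → Ann := fun a => annFlipX (annFlipY a) with hρ
  have hρ2 : ∀ a, annFlipY (annFlipX (ρ a)) = a := fun a => by simp [hρ]
  have hh : ∀ a, ((ρ a).2 : ℝ) = 1 - a.2 := fun a => by simp [hρ]
  have hf : ∀ k : ℕ, S.f^[k] (ρ a) = ρ (S.refl.dual.f^[k] a) := fun k => by
    induction k with
    | zero => rfl
    | succ k ih =>
      rw [Function.iterate_succ_apply', ih, Function.iterate_succ_apply', dual_f, refl_f_symm]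
      simp [hρ]
  have hg : ∀ k : ℕ, S.f.symm^[k] (ρ a) = ρ (S.refl.dual.f.symm^[k] a) := fun k => by
    induction k with
    | zero => rfl
    | succ k ih =>
      rw [Function.iterate_succ_apply', ih, Function.iterate_succ_apply', dual_f_symm, refl_f]
      simp [hρ]
  refine ⟨ρ a, fun h => h1 ?_, fun h => h0 ?_, ?_, ?_⟩
  · simpa [hρ] using h
  · simpa [hρ] using h
  · simp only [hg, hh]
    simpa using hb.const_sub 1
  · simp only [hf, hh]
    simpa using ht.const_sub 1

lemma mem_Ioo_of_ne {y : UI} (h0 : y ≠ 0) (h1 : y ≠ 1) : (y : ℝ) ∈ Ioo (0 : ℝ) 1 :=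
  ⟨y.2.1.lt_of_ne fun e => h0 (Subtype.ext e.symm), y.2.2.lt_of_ne fun e => h1 (Subtype.ext e)⟩

/-- **Mather's theorem.** An area-preserving positive twist map with no invariant graph
except `C₀` and `C₁` has orbits going from one boundary circle to the other, in both
directions. -/
theorem statement2 (f : PositiveTwistMap)
    (hArea : MeasurePreserving f.toFun volume volume)
    (hNoGraph : ∀ ψ : 𝕋 → ℝ, Continuous ψ → (∀ x : 𝕋, ψ x ∈ Set.Icc (0:ℝ) 1) →
      f.toFun '' {z : Ann | (z.2 : ℝ) = ψ z.1} = {z : Ann | (z.2 : ℝ) = ψ z.1} →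
      {z : Ann | (z.2 : ℝ) = ψ z.1} = C0 ∨ {z : Ann | (z.2 : ℝ) = ψ z.1} = C1) :
    (∃ z : Ann, (z.2 : ℝ) ∈ Set.Ioo (0:ℝ) 1 ∧
      Tendsto (fun k : ℤ => Metric.infDist (f.toAnnulusHomeo.iter k z) C0) atBot (𝓝 0) ∧
      Tendsto (fun k : ℤ => Metric.infDist (f.toAnnulusHomeo.iter k z) C1) atTop (𝓝 0)) ∧
    (∃ z' : Ann, (z'.2 : ℝ) ∈ Set.Ioo (0:ℝ) 1 ∧
      Tendsto (fun k : ℤ => Metric.infDist (f.toAnnulusHomeo.iter k z') C1) atBot (𝓝 0) ∧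
      Tendsto (fun k : ℤ => Metric.infDist (f.toAnnulusHomeo.iter k z') C0) atTop (𝓝 0)) := by
  constructor
  · obtain ⟨a, h0, h1, hb, ht⟩ := (f.toTwistSys hArea hNoGraph).exists_connecting_orbit
    exact ⟨a, mem_Ioo_of_ne h0 h1,
      f.tendsto_iter_atBot (g := fun z => Metric.infDist z C0) (tendsto_infDist_C0 hb),
      f.tendsto_iter_atTop (g := fun z => Metric.infDist z C1) (tendsto_infDist_C1 ht)⟩
  · obtain ⟨a, h0, h1, hb, ht⟩ := (f.toTwistSys hArea hNoGraph).exists_connecting_orbit_down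
    exact ⟨a, mem_Ioo_of_ne h0 h1,
      f.tendsto_iter_atBot (g := fun z => Metric.infDist z C1) (tendsto_infDist_C1 hb),
      f.tendsto_iter_atTop (g := fun z => Metric.infDist z C0) (tendsto_infDist_C0 ht)⟩
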